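/- Let v_{ε,a} be a global minimizer of E and assume a/(ε|ln ε|) is bounded as ε → 0. Then for every ρ₀ ∈ (0,ρ): liminf_{ε→0} (1/|ln ε|) ∫_{ρ₀ ≤ |x| ≤ ρ} (1/2)|∇v_{ε,a}|² ≥ π|μ₁|ρ/6, where μ₁ = μ_rad'(ρ). -/

import Mathlib

open MeasureTheory Filter Real Set
open scoped Topology ENNReal

noncomputable section

/-- We identify the plane with the Euclidean space `ℝ²`. -/
abbrev E2 : Type := EuclideanSpace ℝ (Fin 2)

/-- The standard basis vectors of `ℝ²`. -/
def e2basis (i : Fin 2) : E2 := EuclideanSpace.single i 1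

/-- Rotation of a vector by `π/2` (multiplication by `i` in complex notation). -/
def perp (e : E2) : E2 := EuclideanSpace.single 0 (-(e 1)) + EuclideanSpace.single 1 (e 0)

/-- The unit vector `e^{iθ}`. -/
def uvec (θ : ℝ) : E2 := EuclideanSpace.single 0 (Real.cos θ) + EuclideanSpace.single 1 (Real.sin θ)

/-- The Laplacian of a map `u : ℝ² → ℝ²`. -/
def lap (u : E2 → E2) (x : E2) : E2 :=
  ∑ i : Fin 2, fderiv ℝ (fun y => fderiv ℝ u y (e2basis i)) x (e2basis i)

/-- `|∇u|²`, the squared Hilbert-Schmidt norm of the full gradient of `u : ℝ² → ℝ²`. -/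
def gradSq (u : E2 → E2) (x : E2) : ℝ := ∑ i : Fin 2, ‖fderiv ℝ u x (e2basis i)‖ ^ 2

/-- `∑_j ∇u_j · ∇ψ_j`, the Hilbert-Schmidt inner product of the gradients. -/
def gradInner (u ψ : E2 → E2) (x : E2) : ℝ :=
  ∑ i : Fin 2, (inner ℝ (fderiv ℝ u x (e2basis i)) (fderiv ℝ ψ x (e2basis i)) : ℝ)

/-- Membership in `H¹(ℝ²,ℝ²)`: `u ∈ L²` together with its gradient. -/
def MemH1 (u : E2 → E2) : Prop :=
  Differentiable ℝ u ∧ MemLp u 2 (volume : Measure E2) ∧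
    MemLp (fun x => fderiv ℝ u x) 2 (volume : Measure E2)

/-- The Ginzburg–Landau energy
`E(u) = ∫ (1/2)|∇u|² − (1/(2ε²))μ|u|² + (1/(4ε²))|u|⁴ − (a/ε) f·u`. -/
def energy (ε a : ℝ) (μ : E2 → ℝ) (f : E2 → E2) (u : E2 → E2) : ℝ :=
  ∫ x : E2, ((1/2) * gradSq u x - (1/(2*ε^2)) * μ x * ‖u x‖^2
    + (1/(4*ε^2)) * ‖u x‖^4 - (a/ε) * (inner ℝ (f x) (u x) : ℝ))

/-- `v` is a global minimizer of `E` over `H¹(ℝ²,ℝ²)`. -/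
def IsMinimizer (ε a : ℝ) (μ : E2 → ℝ) (f : E2 → E2) (v : E2 → E2) : Prop :=
  MemH1 v ∧ ∀ u : E2 → E2, MemH1 u → energy ε a μ f v ≤ energy ε a μ f u

/-- `u` is a smooth classical solution of the Euler–Lagrange equation
`ε²Δu + μu − |u|²u + εa f = 0` on `ℝ²`. -/
def IsSolution (ε a : ℝ) (μ : E2 → ℝ) (f : E2 → E2) (u : E2 → E2) : Prop :=
  ContDiff ℝ (⊤ : ℕ∞) u ∧ ∀ x : E2, ε^2 • lap u x + μ x • u x - ‖u x‖^2 • u x + (ε*a) • f x = 0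

/-- Hypotheses on the radial coefficient `μ`. -/
structure MuHyp (μ : E2 → ℝ) (μrad : ℝ → ℝ) (ρ : ℝ) : Prop where
  smooth : ContDiff ℝ (⊤ : ℕ∞) μ
  smooth_rad : ContDiff ℝ (⊤ : ℕ∞) μrad
  even_rad : ∀ r : ℝ, μrad (-r) = μrad r
  radial : ∀ x : E2, μ x = μrad ‖x‖
  bdd : ∃ C : ℝ, ∀ x : E2, |μ x| ≤ C
  deriv_neg : ∀ r : ℝ, 0 < r → deriv μrad r < 0
  rho_pos : 0 < ρ
  rho_root : μrad ρ = 0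
  rho_unique : ∀ r : ℝ, 0 < r → μrad r = 0 → r = ρ

/-- Hypotheses on the radial vector field `f`. -/
structure FHyp (f : E2 → E2) (frad : ℝ → ℝ) : Prop where
  smooth : ContDiff ℝ (⊤ : ℕ∞) f
  smooth_rad : ContDiff ℝ (⊤ : ℕ∞) frad
  odd_rad : ∀ r : ℝ, frad (-r) = -frad r
  radial : ∀ x : E2, x ≠ 0 → f x = (frad ‖x‖ / ‖x‖) • x
  integrable : Integrable f (volume : Measure E2)
  bdd : ∃ C : ℝ, ∀ x : E2, ‖f x‖ ≤ C
  pos_rad : ∀ r : ℝ, 0 < r → 0 < frad r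

/-- Convergence in `C²_loc(ℝ²,ℝ²)` of a sequence of maps. -/
def TendstoC2LocSeq (F : ℕ → E2 → E2) (g : E2 → E2) : Prop :=
  TendstoLocallyUniformly F g atTop ∧
  TendstoLocallyUniformly (fun n x => fderiv ℝ (F n) x) (fun x => fderiv ℝ g x) atTop ∧
  TendstoLocallyUniformly (fun n x => fderiv ℝ (fderiv ℝ (F n)) x)
    (fun x => fderiv ℝ (fderiv ℝ g) x) atTop

/-- `l` is a limit point (as `ε → 0`) of the set of zeros of the family `v ε`. -/
def IsZeroLimitPoint (v : ℝ → E2 → E2) (l : E2) : Prop :=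
  ∃ (εs : ℕ → ℝ) (xs : ℕ → E2), (∀ n, 0 < εs n) ∧ Tendsto εs atTop (𝓝 (0:ℝ)) ∧
    (∀ n, v (εs n) (xs n) = 0) ∧ Tendsto xs atTop (𝓝 l)

lemma rad_integral (Φ : ℝ → ℝ) :
    ∫ x : E2, Φ (‖x‖ ^ 2) = π * ∫ t in Ioi (0:ℝ), Φ t := by
  have h1 := integral_fun_norm_addHaar (volume : Measure E2) (fun r => Φ (r ^ 2))
  have hb : (volume : Measure E2).real (Metric.ball 0 1) = π := by
    rw [Measure.real, EuclideanSpace.volume_ball_fin_two]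
    simp [pi_pos.le]
  have h2 := integral_comp_rpow_Ioi Φ (p := 2) (by norm_num)
  rw [h1, hb, ← h2]
  simp only [finrank_euclideanSpace, Fintype.card_fin, nsmul_eq_mul, smul_eq_mul]
  have h3 : ∀ y : ℝ, (|(2:ℝ)| * y ^ ((2:ℝ) - 1)) * Φ (y ^ (2:ℝ)) = 2 * (y ^ (2 - 1) * Φ (y ^ 2)) := by
    intro y
    have : (2:ℝ) - 1 = 1 := by norm_num
    rw [this, Real.rpow_one, Real.rpow_two]
    norm_num; ring
  simp only [h3]
  rw [integral_const_mul]
  push_cast; ring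

/-- The annulus `ρ² - T ≤ |x|² ≤ ρ²`. -/
def ann (ρ T : ℝ) : Set E2 := {x : E2 | ρ ^ 2 - T ≤ ‖x‖ ^ 2 ∧ ‖x‖ ^ 2 ≤ ρ ^ 2}

lemma ann_compact (ρ T : ℝ) : IsCompact (ann ρ T) := by
  refine Metric.isCompact_of_isClosed_isBounded ?_ ?_
  · have hc : Continuous (fun x : E2 => ‖x‖ ^ 2) := by fun_prop
    exact (isClosed_le continuous_const hc).inter (isClosed_le hc continuous_const)
  · refine (Metric.isBounded_closedBall (x := (0:E2)) (r := |ρ|)).subset ?_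
    intro x hx
    rw [mem_closedBall_zero_iff]
    have := abs_le_abs_of_sq_le_sq hx.2
    rwa [abs_of_nonneg (norm_nonneg x)] at this
  where
  abs_le_abs_of_sq_le_sq {a b : ℝ} (h : a ^ 2 ≤ b ^ 2) : |a| ≤ |b| := sq_le_sq.mp h

lemma ann_meas (ρ T : ℝ) : MeasurableSet (ann ρ T) := (ann_compact ρ T).measurableSet

lemma rad_ann (ρ T : ℝ) (hT0 : 0 ≤ T) (hT : T ≤ ρ ^ 2) (F : ℝ → ℝ) :
    ∫ x in ann ρ T, F (ρ ^ 2 - ‖x‖ ^ 2) = π * ∫ τ in (0:ℝ)..T, F τ := by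
  have h1 : ∀ x : E2, (ann ρ T).indicator (fun x => F (ρ ^ 2 - ‖x‖ ^ 2)) x =
      (Icc (ρ ^ 2 - T) (ρ ^ 2)).indicator (fun t => F (ρ ^ 2 - t)) (‖x‖ ^ 2) := by
    intro x; rfl
  rw [← integral_indicator (ann_meas ρ T)]
  simp only [h1]
  rw [rad_integral (fun t => (Icc (ρ ^ 2 - T) (ρ ^ 2)).indicator (fun t => F (ρ ^ 2 - t)) t)]
  congr 1
  have h2 : ∫ τ in (0:ℝ)..T, F τ = ∫ t in (ρ^2 - T)..(ρ^2), F (ρ^2 - t) := by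
    rw [intervalIntegral.integral_comp_sub_left]; simp
  rw [h2, intervalIntegral.integral_of_le (by linarith), ← integral_Icc_eq_integral_Ioc,
    ← integral_Ici_eq_integral_Ioi, setIntegral_indicator measurableSet_Icc]
  congr 2
  rw [inter_eq_right]
  intro t ht
  exact le_trans (by linarith) ht.1

lemma ann_integrable (ρ T : ℝ) (F : ℝ → ℝ) (hF : ContinuousOn F (Icc 0 T)) :
    IntegrableOn (fun x : E2 => F (ρ ^ 2 - ‖x‖ ^ 2)) (ann ρ T) := by
  refine ContinuousOn.integrableOn_compact (ann_compact ρ T) ?_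
  refine hF.comp (by fun_prop) ?_
  intro x hx
  exact ⟨by linarith [hx.2], by linarith [hx.1]⟩

section mufacts
variable {μ : E2 → ℝ} {μrad : ℝ → ℝ} {ρ : ℝ}

lemma mu_anti (hμ : MuHyp μ μrad ρ) : StrictAntiOn μrad (Ici 0) := by
  refine strictAntiOn_of_deriv_neg (convex_Ici 0) hμ.smooth_rad.continuous.continuousOn ?_
  intro r hr
  rw [interior_Ici] at hr
  exact hμ.deriv_neg r hr

lemma mu_nonpos (hμ : MuHyp μ μrad ρ) {x : E2} (hx : ρ ≤ ‖x‖) : μ x ≤ 0 := by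
  rw [hμ.radial, ← hμ.rho_root]
  exact (mu_anti hμ).antitoneOn hμ.rho_pos.le (norm_nonneg x) hx

lemma mu_nonneg (hμ : MuHyp μ μrad ρ) {x : E2} (hx : ‖x‖ ≤ ρ) : 0 ≤ μ x := by
  rw [hμ.radial, ← hμ.rho_root]
  exact (mu_anti hμ).antitoneOn (norm_nonneg x) hμ.rho_pos.le hx

lemma deriv_mu_contDiff (hμ : MuHyp μ μrad ρ) : ContDiff ℝ 1 (deriv μrad) := by
  have h : ContDiff ℝ 2 μrad := by exact_mod_cast contDiff_infty.mp hμ.smooth_rad 2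
  have h2 : ContDiff ℝ (1 + 1) μrad := by norm_num; exact h
  exact (contDiff_succ_iff_deriv.mp h2).2.2

lemma mu_differentiable (hμ : MuHyp μ μrad ρ) : Differentiable ℝ μ :=
  hμ.smooth.differentiable (by simp)

lemma murad_differentiable (hμ : MuHyp μ μrad ρ) : Differentiable ℝ μrad :=
  hμ.smooth_rad.differentiable (by simp)

lemma mu_lower (hμ : MuHyp μ μrad ρ) :
    ∃ k > 0, ∀ x : E2, ‖x‖ ≤ ρ → k * (ρ ^ 2 - ‖x‖ ^ 2) ≤ μ x := by
  have hρ := hμ.rho_pos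
  obtain ⟨r1, hr1, hmax⟩ := (isCompact_Icc (a := ρ / 2) (b := ρ)).exists_isMaxOn
    ⟨ρ, by constructor <;> linarith⟩ (deriv_mu_contDiff hμ).continuous.continuousOn
  have hk : deriv μrad r1 < 0 := hμ.deriv_neg r1 (by linarith [hr1.1])
  set k := - deriv μrad r1 with hkdef
  have hkp : 0 < k := by linarith
  have hlin : ∀ r ∈ Icc (ρ / 2) ρ, k * (ρ - r) ≤ μrad r := by
    intro r hr
    have := (convex_Icc (ρ/2) ρ).image_sub_le_mul_sub_of_deriv_le
      hμ.smooth_rad.continuous.continuousOn (murad_differentiable hμ).differentiableOn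
      (C := deriv μrad r1) (fun y hy => hmax (interior_subset hy)) r hr ρ
      ⟨by linarith, le_refl _⟩ hr.2
    rw [hμ.rho_root] at this
    rw [hkdef]; linarith
  refine ⟨k / (4 * ρ), by positivity, fun x hx => ?_⟩
  have hx0 := norm_nonneg x
  have e1 : ρ ^ 2 - ‖x‖ ^ 2 ≤ 2 * ρ * (ρ - ‖x‖) := by nlinarith
  have e2 : k / (4 * ρ) * (ρ ^ 2 - ‖x‖ ^ 2) ≤ k / 2 * (ρ - ‖x‖) := by
    calc _ ≤ k / (4 * ρ) * (2 * ρ * (ρ - ‖x‖)) := by gcongr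
      _ = _ := by field_simp; ring
  refine e2.trans ?_
  rw [hμ.radial]
  by_cases h : ρ / 2 ≤ ‖x‖
  · have := hlin _ ⟨h, hx⟩
    nlinarith
  · push Not at h
    have h1 := hlin (ρ / 2) ⟨le_refl _, by linarith⟩
    have h2 := (mu_anti hμ).antitoneOn hx0 (by simp; linarith : ρ / 2 ∈ Ici (0:ℝ)) h.le
    nlinarith

lemma fderiv_mu_radial (hμ : MuHyp μ μrad ρ) (x : E2) :
    fderiv ℝ μ x x = ‖x‖ * deriv μrad ‖x‖ := by
  have h1 : HasDerivAt (fun t : ℝ => μ (t • x)) (fderiv ℝ μ x x) 1 := by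
    have ha : HasFDerivAt μ (fderiv ℝ μ x) ((1:ℝ) • x) := by
      rw [one_smul]; exact (mu_differentiable hμ x).hasFDerivAt
    have hb : HasDerivAt (fun t : ℝ => t • x) x 1 := by
      simpa using (hasDerivAt_id (1:ℝ)).smul_const x
    exact ha.comp_hasDerivAt (1:ℝ) hb
  have h2 : HasDerivAt (fun t : ℝ => μrad (t * ‖x‖)) (‖x‖ * deriv μrad ‖x‖) 1 := by
    have ha : HasDerivAt μrad (deriv μrad ‖x‖) ((1:ℝ) * ‖x‖) := by
      rw [one_mul]; exact (murad_differentiable hμ _).hasDerivAt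
    have hb : HasDerivAt (fun t : ℝ => t * ‖x‖) (‖x‖) 1 := by
      simpa using (hasDerivAt_id (1:ℝ)).mul_const ‖x‖
    have := ha.comp (1:ℝ) hb
    rw [mul_comm]; exact this
  refine h1.unique (h2.congr_of_eventuallyEq ?_)
  filter_upwards [lt_mem_nhds (show (0:ℝ) < 1 by norm_num)] with t ht
  rw [hμ.radial, norm_smul, Real.norm_of_nonneg ht.le]

lemma mu_taylor (hμ : MuHyp μ μrad ρ) :
    ∃ C ≥ 0, ∀ x : E2, ‖x‖ ≤ ρ →
      ρ * |deriv μrad ρ| - C * (ρ ^ 2 - ‖x‖ ^ 2) ≤ - fderiv ℝ μ x x ∧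
      μ x ≤ |deriv μrad ρ| * (ρ ^ 2 - ‖x‖ ^ 2) / (2 * ρ) + C * (ρ ^ 2 - ‖x‖ ^ 2) ^ 2 := by
  have hρ := hμ.rho_pos
  have hd := deriv_mu_contDiff hμ
  obtain ⟨L, hL⟩ := (isCompact_Icc (a := 0) (b := ρ)).exists_bound_of_continuousOn
    (hd.continuous_deriv (le_refl _)).continuousOn
  have hL0 : 0 ≤ L := (norm_nonneg _).trans (hL 0 ⟨le_refl _, hρ.le⟩)
  have hm : |deriv μrad ρ| = - deriv μrad ρ := abs_of_neg (hμ.deriv_neg ρ hρ)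
  set m := |deriv μrad ρ| with hmdef
  have hm0 : 0 ≤ m := abs_nonneg _
  have hlip : ∀ r ∈ Icc 0 ρ, |deriv μrad r + m| ≤ L * (ρ - r) := by
    intro r hr
    have := (convex_Icc 0 ρ).norm_image_sub_le_of_norm_deriv_le
      (fun y _ => (hd.differentiable (by simp)) y) hL (x := ρ) (y := r) ⟨hρ.le, le_refl _⟩ hr
    rw [Real.norm_eq_abs, Real.norm_eq_abs] at this
    rw [hm, ← sub_eq_add_neg]
    rwa [abs_sub_comm r ρ, abs_of_nonneg (by linarith [hr.2] : 0 ≤ ρ - r)] at this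
  refine ⟨m / ρ + L + m / (2 * ρ ^ 3) + L / ρ ^ 2, by positivity, fun x hx => ?_⟩
  rw [fderiv_mu_radial hμ, hμ.radial]
  set r := ‖x‖ with hr
  have hr0 : 0 ≤ r := norm_nonneg x
  set τ := ρ ^ 2 - r ^ 2 with hτ
  have hτ0 : 0 ≤ τ := by rw [hτ]; nlinarith
  have hs : ρ - r ≤ τ / ρ := by rw [le_div_iff₀ hρ, hτ]; nlinarith
  have hs0 : 0 ≤ ρ - r := by linarith
  have hs2 : (ρ - r) ^ 2 ≤ τ ^ 2 / ρ ^ 2 := by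
    rw [← div_pow]; exact pow_le_pow_left₀ hs0 hs 2
  constructor
  · have h1 := (abs_le.mp (hlip r ⟨hr0, hx⟩)).2
    have h2 : r * deriv μrad r ≤ r * (L * (ρ - r) - m) := by
      apply mul_le_mul_of_nonneg_left _ hr0; linarith
    have h3 : r * (L * (ρ - r)) ≤ L * τ := by
      have : r * (ρ - r) ≤ τ := by rw [hτ]; nlinarith
      nlinarith
    have h4 : m * (ρ - r) ≤ m / ρ * τ := by
      calc _ ≤ m * (τ / ρ) := by gcongr
        _ = _ := by ring
    have h5 : 0 ≤ (m / (2 * ρ ^ 3) + L / ρ ^ 2) * τ := by positivity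
    nlinarith
  · have h1 : μrad r ≤ (m + L * (ρ - r)) * (ρ - r) := by
      have := (convex_Icc r ρ).mul_sub_le_image_sub_of_le_deriv
        hμ.smooth_rad.continuous.continuousOn (murad_differentiable hμ).differentiableOn
        (C := -(m + L * (ρ - r))) (fun y hy => ?_) r ⟨le_refl _, hx⟩ ρ ⟨hx, le_refl _⟩ hx
      · rw [hμ.rho_root] at this; linarith
      · have hy' := interior_subset hy
        have h1 := (abs_le.mp (hlip y ⟨hr0.trans hy'.1, hy'.2⟩)).1
        have : L * (ρ - y) ≤ L * (ρ - r) := by gcongr; exact hy'.1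
        linarith
    have h2 : ρ - r = τ / (2 * ρ) + (ρ - r) ^ 2 / (2 * ρ) := by
      rw [hτ]; field_simp; ring
    have h3 : m * (ρ - r) ≤ m * τ / (2 * ρ) + m / (2 * ρ ^ 3) * τ ^ 2 := by
      calc m * (ρ - r) = m * (τ / (2 * ρ) + (ρ - r) ^ 2 / (2 * ρ)) := by rw [← h2]
        _ ≤ m * (τ / (2 * ρ) + (τ ^ 2 / ρ ^ 2) / (2 * ρ)) := by gcongr
        _ = _ := by field_simp
    have h4 : L * (ρ - r) ^ 2 ≤ L / ρ ^ 2 * τ ^ 2 := by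
      calc _ ≤ L * (τ ^ 2 / ρ ^ 2) := by gcongr
        _ = _ := by ring
    have h5 : 0 ≤ (m / ρ + L) * τ ^ 2 := by positivity
    nlinarith

end mufacts

/-- Regularised square root. -/
def Freg (δ m : ℝ) : ℝ := √m * m / (max m 0 + δ)

/-- Derivative of the regularised square root. -/
def Freg' (δ m : ℝ) : ℝ := (3 / 2) * √m / (max m 0 + δ) - √m * m / (max m 0 + δ) ^ 2

lemma Freg_of_nonpos {δ m : ℝ} (hm : m ≤ 0) : Freg δ m = 0 := by
  simp [Freg, Real.sqrt_eq_zero_of_nonpos hm]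

lemma Freg'_of_nonpos {δ m : ℝ} (hm : m ≤ 0) : Freg' δ m = 0 := by
  simp [Freg', Real.sqrt_eq_zero_of_nonpos hm]

lemma Freg_continuous {δ : ℝ} (hδ : 0 < δ) : Continuous (Freg δ) := by
  unfold Freg
  refine Continuous.div (by fun_prop) (by fun_prop) fun m => ?_
  have : 0 ≤ max m 0 := le_max_right _ _
  linarith

lemma Freg'_continuous {δ : ℝ} (hδ : 0 < δ) : Continuous (Freg' δ) := by
  unfold Freg'
  have h : ∀ m : ℝ, max m 0 + δ ≠ 0 := fun m => by
    have : 0 ≤ max m 0 := le_max_right _ _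
    linarith
  refine Continuous.sub ?_ ?_
  · exact Continuous.div (by fun_prop) (by fun_prop) h
  · exact Continuous.div (by fun_prop) (by fun_prop) fun m => pow_ne_zero _ (h m)

lemma Freg_hasDerivAt {δ : ℝ} (hδ : 0 < δ) (m : ℝ) : HasDerivAt (Freg δ) (Freg' δ m) m := by
  rcases lt_trichotomy m 0 with h | h | h
  · rw [Freg'_of_nonpos h.le]
    refine (hasDerivAt_const m (0:ℝ)).congr_of_eventuallyEq ?_
    filter_upwards [gt_mem_nhds h] with y hy
    exact Freg_of_nonpos hy.le
  · subst h
    rw [Freg'_of_nonpos le_rfl, hasDerivAt_iff_isLittleO_nhds_zero]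
    rw [Asymptotics.isLittleO_iff]
    intro c hc
    have hs : Tendsto (fun y : ℝ => √y) (𝓝 0) (𝓝 0) := by
      simpa using (Real.continuous_sqrt.tendsto 0)
    filter_upwards [hs.eventually (gt_mem_nhds (show 0 < c * δ by positivity))] with y hy
    simp only [zero_add, Freg_of_nonpos le_rfl, sub_zero, smul_zero]
    unfold Freg
    have hD : δ ≤ max y 0 + δ := by linarith [le_max_right y 0]
    rw [norm_div, norm_mul, Real.norm_of_nonneg (Real.sqrt_nonneg y),
      Real.norm_of_nonneg (by linarith : 0 ≤ max y 0 + δ), div_le_iff₀ (by linarith)]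
    have := norm_nonneg y
    calc √y * ‖y‖ ≤ c * δ * ‖y‖ := by gcongr
      _ = c * ‖y‖ * δ := by ring
      _ ≤ _ := by gcongr
  · have h1 : HasDerivAt (fun y : ℝ => √y * y / (y + δ))
        (((1 / (2 * √m)) * m + √m * 1) / (m + δ) - (√m * m) * 1 / (m + δ) ^ 2) m := by
      have ha := ((Real.hasDerivAt_sqrt h.ne').mul (hasDerivAt_id m)).div
        ((hasDerivAt_id m).add_const δ) (by simp; linarith)
      refine ha.congr_deriv ?_
      have : m + δ ≠ 0 := by linarith
      simp only [Pi.mul_apply, id]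
      field_simp
    have h2 : ((1 / (2 * √m)) * m + √m * 1) / (m + δ) - (√m * m) * 1 / (m + δ) ^ 2 = Freg' δ m := by
      unfold Freg'
      rw [max_eq_left h.le]
      have hs : √m * √m = m := Real.mul_self_sqrt h.le
      have hs0 : √m ≠ 0 := (Real.sqrt_pos.mpr h).ne'
      have : 1 / (2 * √m) * m = √m / 2 := by
        field_simp; nlinarith
      rw [this]; ring
    rw [← h2]
    refine h1.congr_of_eventuallyEq ?_
    filter_upwards [lt_mem_nhds h] with y hy
    simp [Freg, max_eq_left hy.le]

lemma Freg'_sq {δ m : ℝ} (hδ : 0 < δ) (hm : 0 ≤ m) : Freg' δ m ^ 2 ≤ (9 / 4) / (m + δ) := by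
  have hD : 0 < m + δ := by linarith
  have hs : √m ^ 2 = m := Real.sq_sqrt hm
  have e : Freg' δ m = √m * ((3/2) * (m + δ) - m) / (m + δ) ^ 2 := by
    unfold Freg'
    rw [max_eq_left hm]
    field_simp
  rw [e, div_pow, mul_pow, hs, div_le_div_iff₀ (by positivity) hD]
  have h1 : ((3/2) * (m + δ) - m) ^ 2 ≤ (9/4) * (m + δ) ^ 2 := by nlinarith
  calc m * ((3/2) * (m + δ) - m) ^ 2 * (m + δ) ≤ (m + δ) * ((9/4) * (m + δ) ^ 2) * (m + δ) := by
        gcongr; linarith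
    _ = _ := by ring

lemma Freg_sq {δ m : ℝ} (hm : 0 ≤ m) : Freg δ m ^ 2 = m ^ 3 / (m + δ) ^ 2 := by
  unfold Freg
  rw [max_eq_left hm, div_pow, mul_pow, Real.sq_sqrt hm]; ring

lemma Freg_sq_le {δ m : ℝ} (hδ : 0 < δ) (hm : 0 ≤ m) : Freg δ m ^ 2 ≤ m := by
  rw [Freg_sq hm, div_le_iff₀ (by positivity)]
  nlinarith [mul_nonneg hm hδ.le, mul_nonneg (mul_nonneg hm hδ.le) hm,
    mul_nonneg (mul_nonneg hm hδ.le) hδ.le]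

lemma Freg_sq_ge {δ m : ℝ} (hδ : 0 < δ) (hm : 0 ≤ m) : m - 2 * δ ≤ Freg δ m ^ 2 := by
  rw [Freg_sq hm, le_div_iff₀ (by positivity)]
  nlinarith [mul_nonneg hm hδ.le, mul_nonneg (mul_nonneg hm hδ.le) hm,
    mul_nonneg (mul_nonneg hm hδ.le) hδ.le, pow_pos hδ 3]

/-- The pointwise key inequality for the test function. -/
lemma Freg_pot {δ m : ℝ} (hδ : 0 < δ) :
    (Freg δ m ^ 2) ^ 2 - 2 * m * Freg δ m ^ 2 ≤ - (max m 0) ^ 2 + (2 * δ) ^ 2 := by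
  rcases le_total m 0 with h | h
  · rw [Freg_of_nonpos h, max_eq_right h]; nlinarith [sq_nonneg δ]
  · rw [max_eq_left h]
    nlinarith [Freg_sq_le hδ h, Freg_sq_ge hδ h]

/-- The comparison map. -/
def testMap (μ : E2 → ℝ) (δ : ℝ) (x : E2) : E2 := Freg δ (μ x) • e2basis 0

lemma norm_e2basis (i : Fin 2) : ‖e2basis i‖ = 1 := by simp [e2basis]

section test
variable {μ : E2 → ℝ} {μrad : ℝ → ℝ} {ρ : ℝ}

lemma testMap_norm_sq (μ : E2 → ℝ) (δ : ℝ) (x : E2) : ‖testMap μ δ x‖ ^ 2 = Freg δ (μ x) ^ 2 := by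
  rw [testMap, norm_smul, norm_e2basis, mul_one, Real.norm_eq_abs, sq_abs]

lemma testMap_hasFDerivAt (hμ : MuHyp μ μrad ρ) {δ : ℝ} (hδ : 0 < δ) (x : E2) :
    HasFDerivAt (testMap μ δ) ((Freg' δ (μ x) • fderiv ℝ μ x).smulRight (e2basis 0)) x :=
  ((Freg_hasDerivAt hδ (μ x)).comp_hasFDerivAt x
    (mu_differentiable hμ x).hasFDerivAt).smul_const (e2basis 0)

lemma testMap_fderiv (hμ : MuHyp μ μrad ρ) {δ : ℝ} (hδ : 0 < δ) :
    fderiv ℝ (testMap μ δ) = fun x => (Freg' δ (μ x) • fderiv ℝ μ x).smulRight (e2basis 0) :=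
  funext fun x => (testMap_hasFDerivAt hμ hδ x).fderiv

lemma fderiv_mu_continuous (hμ : MuHyp μ μrad ρ) : Continuous (fderiv ℝ μ) :=
  hμ.smooth.continuous_fderiv (by simp)

lemma testMap_fderiv_continuous (hμ : MuHyp μ μrad ρ) {δ : ℝ} (hδ : 0 < δ) :
    Continuous (fderiv ℝ (testMap μ δ)) := by
  rw [testMap_fderiv hμ hδ]
  have h1 := (Freg'_continuous hδ).comp hμ.smooth.continuous
  have h2 : Continuous fun x => Freg' δ (μ x) • fderiv ℝ μ x := h1.smul (fderiv_mu_continuous hμ)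
  exact ((ContinuousLinearMap.smulRightL ℝ E2 E2).continuous.comp h2).clm_apply continuous_const

lemma testMap_continuous (hμ : MuHyp μ μrad ρ) {δ : ℝ} (hδ : 0 < δ) :
    Continuous (testMap μ δ) :=
  ((Freg_continuous hδ).comp hμ.smooth.continuous).smul continuous_const

lemma testMap_zero (hμ : MuHyp μ μrad ρ) {δ : ℝ} {x : E2} (hx : ρ ≤ ‖x‖) : testMap μ δ x = 0 := by
  rw [testMap, Freg_of_nonpos (mu_nonpos hμ hx), zero_smul]

lemma cs_of_zero {β : Type*} [Zero β] {g : E2 → β} (hg : ∀ x : E2, ρ < ‖x‖ → g x = 0) :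
    HasCompactSupport g := by
  refine HasCompactSupport.intro (isCompact_closedBall (0:E2) ρ) fun x hx => hg x ?_
  simpa using hx

lemma testMap_fderiv_zero (hμ : MuHyp μ μrad ρ) {δ : ℝ} (hδ : 0 < δ) {x : E2} (hx : ρ ≤ ‖x‖) :
    fderiv ℝ (testMap μ δ) x = 0 := by
  rw [testMap_fderiv hμ hδ]
  ext
  simp [Freg'_of_nonpos (mu_nonpos hμ hx)]

lemma testMap_memH1 (hμ : MuHyp μ μrad ρ) {δ : ℝ} (hδ : 0 < δ) : MemH1 (testMap μ δ) := by
  refine ⟨fun x => (testMap_hasFDerivAt hμ hδ x).differentiableAt, ?_, ?_⟩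
  · exact (testMap_continuous hμ hδ).memLp_of_hasCompactSupport
      (cs_of_zero (ρ := ρ) fun x hx => testMap_zero hμ hx.le)
  · exact (testMap_fderiv_continuous hμ hδ).memLp_of_hasCompactSupport
      (cs_of_zero (ρ := ρ) fun x hx => testMap_fderiv_zero hμ hδ hx.le)

lemma gradSq_continuous {u : E2 → E2} (h : Continuous (fderiv ℝ u)) : Continuous (gradSq u) := by
  unfold gradSq; fun_prop

lemma testMap_gradSq (hμ : MuHyp μ μrad ρ) {δ : ℝ} (hδ : 0 < δ) (x : E2) :
    gradSq (testMap μ δ) x ≤ 2 * (Freg' δ (μ x) ^ 2 * ‖fderiv ℝ μ x‖ ^ 2) := by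
  unfold gradSq
  rw [testMap_fderiv hμ hδ]
  have : ∀ i : Fin 2, ‖((Freg' δ (μ x) • fderiv ℝ μ x).smulRight (e2basis 0)) (e2basis i)‖ ^ 2
      ≤ Freg' δ (μ x) ^ 2 * ‖fderiv ℝ μ x‖ ^ 2 := by
    intro i
    simp only [ContinuousLinearMap.smulRight_apply, norm_smul, norm_e2basis, mul_one,
      smul_apply, smul_eq_mul, norm_mul]
    rw [mul_pow, Real.norm_eq_abs, sq_abs]
    gcongr
    have := (fderiv ℝ μ x).le_opNorm (e2basis i)
    rwa [norm_e2basis, mul_one] at this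
  rw [Fin.sum_univ_two]
  linarith [this 0, this 1]

lemma muP_cs (hμ : MuHyp μ μrad ρ) : HasCompactSupport fun x => max (μ x) 0 ^ 2 :=
  cs_of_zero (ρ := ρ) fun x hx => by simp [max_eq_right (mu_nonpos hμ hx.le)]

lemma muP_continuous (hμ : MuHyp μ μrad ρ) : Continuous fun x => max (μ x) 0 ^ 2 := by
  have := hμ.smooth.continuous
  fun_prop

lemma muP_integrable (hμ : MuHyp μ μrad ρ) : Integrable fun x => max (μ x) 0 ^ 2 :=
  (muP_continuous hμ).integrable_of_hasCompactSupport (muP_cs hμ)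

lemma muP_pos (hμ : MuHyp μ μrad ρ) : 0 < ∫ x, max (μ x) 0 ^ 2 := by
  refine (muP_continuous hμ).integral_pos_of_hasCompactSupport_nonneg_nonzero (muP_cs hμ)
    (fun x => by positivity) (x := 0) ?_
  obtain ⟨k, hk, h⟩ := mu_lower hμ
  have h0 := h 0 (by simpa using hμ.rho_pos.le)
  have hρ := hμ.rho_pos
  have : 0 < μ 0 := lt_of_lt_of_le (by simp; positivity) h0
  rw [max_eq_left this.le]
  positivity

/-- The energy of the comparison map. -/
lemma testMap_energy (hμ : MuHyp μ μrad ρ) {f : E2 → E2} {frad : ℝ → ℝ} (hf : FHyp f frad) :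
    ∃ C ≥ 0, ∀ ε a : ℝ, 0 < ε → ε ≤ 1 → 0 ≤ a →
      energy ε a μ f (testMap μ ε) ≤ C * (1 + |Real.log ε| + a / ε)
        - (1 / (4 * ε ^ 2)) * ∫ x, max (μ x) 0 ^ 2 := by
  have hρ := hμ.rho_pos
  obtain ⟨k, hk, hkμ⟩ := mu_lower hμ
  obtain ⟨M, hM⟩ := hμ.bdd
  have hM0 : 0 ≤ M := (abs_nonneg _).trans (hM 0)
  obtain ⟨L, hL⟩ := (isCompact_closedBall (0:E2) ρ).exists_bound_of_continuousOn
    (fderiv_mu_continuous hμ).continuousOn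
  have hL0 : 0 ≤ L := (norm_nonneg _).trans (hL 0 (by simp [hρ.le]))
  set Nf := ∫ x, ‖f x‖ with hNf
  have hNf0 : 0 ≤ Nf := integral_nonneg fun x => norm_nonneg _
  have hlog : 0 ≤ Real.log (k * ρ ^ 2 + 1) := Real.log_nonneg (by nlinarith [pow_pos hρ 2])
  set K := π * (9 / 4 * L ^ 2) / k with hK
  have hK0 : 0 ≤ K := by positivity
  refine ⟨K * (1 + Real.log (k * ρ ^ 2 + 1)) + π * ρ ^ 2 + (1 + M) * Nf, by positivity, ?_⟩
  intro ε a hε hε1 ha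
  have hball : ∀ x : E2, x ∈ ann ρ (ρ ^ 2) ↔ ‖x‖ ≤ ρ := by
    intro x
    simp only [ann, sub_self, mem_ofPred_eq]
    constructor
    · intro h; exact (pow_le_pow_iff_left₀ (norm_nonneg x) hρ.le (by norm_num)).mp h.2
    · intro h; exact ⟨by positivity, by gcongr⟩
  -- majorant
  set H : ℝ → ℝ := fun τ => (9 / 4 * L ^ 2) / (k * τ + ε) + 1 with hH
  have hHc : ContinuousOn H (Icc 0 (ρ ^ 2)) := by
    apply ContinuousOn.add _ continuousOn_const
    apply ContinuousOn.div continuousOn_const (by fun_prop)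
    intro τ hτ
    have := hτ.1
    positivity
  have hHi := ann_integrable ρ (ρ ^ 2) H hHc
  have hHi' := (integrable_indicator_iff (ann_meas ρ (ρ^2))).mpr hHi
  have hae : 0 ≤ a / ε := by positivity
  have hpt : ∀ x : E2, (1/2) * gradSq (testMap μ ε) x - (1/(2*ε^2)) * μ x * ‖testMap μ ε x‖^2
      + (1/(4*ε^2)) * ‖testMap μ ε x‖^4 - (a/ε) * (inner ℝ (f x) (testMap μ ε x) : ℝ) ≤
      (ann ρ (ρ^2)).indicator (fun x => H (ρ ^ 2 - ‖x‖ ^ 2)) x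
        - (1 / (4 * ε ^ 2)) * max (μ x) 0 ^ 2 + (a / ε * (1 + M)) * ‖f x‖ := by
    intro x
    have hin : -((a/ε) * (inner ℝ (f x) (testMap μ ε x) : ℝ)) ≤ (a / ε * (1 + M)) * ‖f x‖ := by
      have h1 : -(inner ℝ (f x) (testMap μ ε x) : ℝ) ≤ ‖f x‖ * ‖testMap μ ε x‖ :=
        (neg_le_abs _).trans (abs_real_inner_le_norm _ _)
      have h2 : ‖testMap μ ε x‖ ≤ 1 + M := by
        have h3 := testMap_norm_sq μ ε x
        have h4 : Freg ε (μ x) ^ 2 ≤ M := by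
          rcases le_total (μ x) 0 with h | h
          · rw [Freg_of_nonpos h]; simpa using hM0
          · exact (Freg_sq_le hε h).trans ((le_abs_self _).trans (hM x))
        nlinarith [norm_nonneg (testMap μ ε x)]
      have h3 : ‖f x‖ * ‖testMap μ ε x‖ ≤ ‖f x‖ * (1 + M) := by gcongr
      calc -((a/ε) * (inner ℝ (f x) (testMap μ ε x) : ℝ))
          = (a / ε) * (-(inner ℝ (f x) (testMap μ ε x) : ℝ)) := by ring
        _ ≤ (a / ε) * (‖f x‖ * (1 + M)) := by gcongr; linarith
        _ = _ := by ring
    have hpot : - (1/(2*ε^2)) * μ x * ‖testMap μ ε x‖^2 + (1/(4*ε^2)) * ‖testMap μ ε x‖^4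
        = (1 / (4 * ε ^ 2)) * ((Freg ε (μ x) ^ 2) ^ 2 - 2 * μ x * Freg ε (μ x) ^ 2) := by
      have : ‖testMap μ ε x‖ ^ 4 = (‖testMap μ ε x‖ ^ 2) ^ 2 := by ring
      rw [this, testMap_norm_sq]
      field_simp; ring
    by_cases hx : ‖x‖ ≤ ρ
    · rw [indicator_of_mem ((hball x).mpr hx)]
      have hm := mu_nonneg hμ hx
      have h1 := Freg_pot (m := μ x) hε
      have h2 : (1 / (4 * ε ^ 2)) * ((Freg ε (μ x) ^ 2) ^ 2 - 2 * μ x * Freg ε (μ x) ^ 2)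
          ≤ - (1 / (4 * ε ^ 2)) * max (μ x) 0 ^ 2 + 1 := by
        calc _ ≤ (1 / (4 * ε ^ 2)) * (- (max (μ x) 0) ^ 2 + (2 * ε) ^ 2) := by gcongr
          _ = _ := by field_simp; ring
      have h3 : (1/2) * gradSq (testMap μ ε) x ≤ (9 / 4 * L ^ 2) / (k * (ρ ^ 2 - ‖x‖ ^ 2) + ε) := by
        have h4 := testMap_gradSq hμ hε x
        have h5 := Freg'_sq hε hm
        have h6 : ‖fderiv ℝ μ x‖ ^ 2 ≤ L ^ 2 := by
          have := hL x (by simpa using hx)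
          gcongr
        have h0 : 0 ≤ k * (ρ ^ 2 - ‖x‖ ^ 2) := by
          apply mul_nonneg hk.le; nlinarith [norm_nonneg x]
        calc (1/2) * gradSq (testMap μ ε) x ≤ Freg' ε (μ x) ^ 2 * ‖fderiv ℝ μ x‖ ^ 2 := by linarith
          _ ≤ (9 / 4) / (μ x + ε) * L ^ 2 := by gcongr
          _ ≤ (9 / 4) / (k * (ρ ^ 2 - ‖x‖ ^ 2) + ε) * L ^ 2 := by
              gcongr
              exact hkμ x hx
          _ = _ := by ring
      simp only [hH]
      linarith
    · have hx' : x ∉ ann ρ (ρ ^ 2) := fun h => hx ((hball x).mp h)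
      push Not at hx
      rw [indicator_of_notMem hx']
      have h1 : gradSq (testMap μ ε) x = 0 := by
        simp [gradSq, testMap_fderiv_zero hμ hε hx.le]
      have h2 := Freg_of_nonpos (δ := ε) (mu_nonpos hμ hx.le)
      rw [h2] at hpot
      rw [h1, max_eq_right (mu_nonpos hμ hx.le)]
      norm_num at hpot ⊢
      linarith
  have hint : Integrable fun x : E2 => (1/2) * gradSq (testMap μ ε) x
      - (1/(2*ε^2)) * μ x * ‖testMap μ ε x‖^2
      + (1/(4*ε^2)) * ‖testMap μ ε x‖^4 - (a/ε) * (inner ℝ (f x) (testMap μ ε x) : ℝ) := by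
    refine Continuous.integrable_of_hasCompactSupport ?_ (cs_of_zero (ρ := ρ) fun x hx => ?_)
    · have h1 := gradSq_continuous (testMap_fderiv_continuous hμ hε)
      have h2 := testMap_continuous hμ hε
      have h3 := hμ.smooth.continuous
      have h4 := hf.smooth.continuous
      have h5 : Continuous fun x => (inner ℝ (f x) (testMap μ ε x) : ℝ) := h4.inner h2
      fun_prop
    · have h1 : gradSq (testMap μ ε) x = 0 := by
        simp [gradSq, testMap_fderiv_zero hμ hε hx.le]
      rw [h1, testMap_zero hμ hx.le]; simp
  have hi2 := (muP_integrable hμ).const_mul (1 / (4 * ε ^ 2))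
  have hi3 := hf.integrable.norm.const_mul (a / ε * (1 + M))
  have hmono := integral_mono hint ((hHi'.sub hi2).add hi3) hpt
  rw [integral_add' (hHi'.sub hi2) hi3, integral_sub' hHi' hi2, integral_const_mul,
      integral_const_mul, integral_indicator (ann_meas _ _), rad_ann ρ _ (by positivity) le_rfl]
      at hmono
  have hH1 : ∫ τ in (0:ℝ)..(ρ^2), H τ
      = (9 / 4 * L ^ 2) / k * (Real.log (k * ρ ^ 2 + ε) - Real.log ε) + ρ ^ 2 := by
    have : ∀ τ ∈ uIcc 0 (ρ ^ 2), HasDerivAt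
        (fun τ => (9 / 4 * L ^ 2) / k * Real.log (k * τ + ε) + τ) (H τ) τ := by
      intro τ hτ
      rw [uIcc_of_le (by positivity)] at hτ
      have h0 : k * τ + ε ≠ 0 := by
        have := hτ.1
        positivity
      have h1 : HasDerivAt (fun τ => k * τ + ε) k τ := by
        simpa using ((hasDerivAt_id τ).const_mul k).add_const ε
      refine (((h1.log h0).const_mul _).add (hasDerivAt_id τ)).congr_deriv ?_
      simp only [hH]
      field_simp
    rw [intervalIntegral.integral_eq_sub_of_hasDerivAt this]
    · simp; ring
    · exact ContinuousOn.intervalIntegrable (by rwa [uIcc_of_le (by positivity)])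
  have hlogε : -Real.log ε = |Real.log ε| := (abs_of_nonpos (Real.log_nonpos hε.le hε1)).symm
  have hl2 : Real.log (k * ρ ^ 2 + ε) ≤ Real.log (k * ρ ^ 2 + 1) := by
    apply Real.log_le_log (by positivity); linarith
  unfold energy
  refine hmono.trans ?_
  rw [hH1]
  have hp : π * ((9 / 4 * L ^ 2) / k * (Real.log (k * ρ ^ 2 + ε) - Real.log ε) + ρ ^ 2)
      ≤ K * (Real.log (k * ρ ^ 2 + 1) + |Real.log ε|) + π * ρ ^ 2 := by
    have : π * ((9 / 4 * L ^ 2) / k * (Real.log (k * ρ ^ 2 + ε) - Real.log ε) + ρ ^ 2)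
      = K * (Real.log (k * ρ ^ 2 + ε) - Real.log ε) + π * ρ ^ 2 := by rw [hK]; ring
    rw [this]
    gcongr; linarith
  have hq1 := mul_nonneg hK0 hlog
  have hq2 : 0 ≤ π * ρ ^ 2 := by positivity
  have hq3 : 0 ≤ (1 + M) * Nf := by positivity
  have hl := abs_nonneg (Real.log ε)
  nlinarith [mul_nonneg hq1 hl, mul_nonneg hq1 hae, mul_nonneg hq2 hl, mul_nonneg hq2 hae,
    mul_nonneg hq3 hl, mul_nonneg hK0 hae]

end test

lemma memLp_partial {u : E2 → E2} (hu : MemH1 u) (i : Fin 2) :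
    MemLp (fun x => fderiv ℝ u x (e2basis i)) 2 (volume : Measure E2) :=
  (ContinuousLinearMap.apply ℝ E2 (e2basis i)).comp_memLp' hu.2.2

lemma gradSq_integrable {u : E2 → E2} (hu : MemH1 u) : Integrable (gradSq u) := by
  have h : ∀ i : Fin 2, Integrable fun x => ‖fderiv ℝ u x (e2basis i)‖ ^ 2 := fun i =>
    (memLp_partial hu i).integrable_norm_pow (by norm_num)
  exact integrable_finsetSum _ fun i _ => h i

lemma gradSq_nonneg (u : E2 → E2) (x : E2) : 0 ≤ gradSq u x := by
  unfold gradSq; positivity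

section apriori
variable {μ : E2 → ℝ} {μrad : ℝ → ℝ} {ρ : ℝ} {f : E2 → E2} {frad : ℝ → ℝ}

lemma energy_lower (hμ : MuHyp μ μrad ρ) (hf : FHyp f frad) :
    ∃ C ≥ 0, ∀ (ε a : ℝ) (v : E2 → E2), 0 < ε → 0 ≤ a → MemH1 v → energy ε a μ f v < 0 →
      Integrable (fun x => (‖v x‖ ^ 2 - max (μ x) 0) ^ 2) ∧
      (1 / 2) * (∫ x, gradSq v x) + (1 / (8 * ε ^ 2)) * (∫ x, (‖v x‖ ^ 2 - max (μ x) 0) ^ 2)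
        ≤ energy ε a μ f v + (1 / (4 * ε ^ 2)) * (∫ x, max (μ x) 0 ^ 2)
          + C * (a / ε + a ^ 2) := by
  obtain ⟨M, hM⟩ := hμ.bdd
  have hM0 : 0 ≤ M := (abs_nonneg _).trans (hM 0)
  obtain ⟨N, hN⟩ := hf.bdd
  have hN0 : 0 ≤ N := (norm_nonneg _).trans (hN 0)
  set Nf := ∫ x, ‖f x‖ with hNf
  have hNf0 : 0 ≤ Nf := integral_nonneg fun x => norm_nonneg _
  refine ⟨((1 + M) + 2 * N) * Nf, by positivity, ?_⟩
  intro ε a v hε ha hv hneg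
  have hint : Integrable fun x : E2 => (1/2) * gradSq v x
      - (1/(2*ε^2)) * μ x * ‖v x‖^2
      + (1/(4*ε^2)) * ‖v x‖^4 - (a/ε) * (inner ℝ (f x) (v x) : ℝ) := by
    by_contra h
    have := integral_undef h
    unfold energy at hneg
    linarith
  have hae : 0 ≤ a / ε := by positivity
  set c := a / ε * (1 + M) + 2 * a ^ 2 * N with hc
  have hpt : ∀ x : E2, (1/2) * gradSq v x + (1 / (8 * ε ^ 2)) * (‖v x‖ ^ 2 - max (μ x) 0) ^ 2 ≤
      ((1/2) * gradSq v x - (1/(2*ε^2)) * μ x * ‖v x‖^2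
      + (1/(4*ε^2)) * ‖v x‖^4 - (a/ε) * (inner ℝ (f x) (v x) : ℝ))
      + (1 / (4 * ε ^ 2)) * max (μ x) 0 ^ 2 + c * ‖f x‖ := by
    intro x
    set h := ‖v x‖ ^ 2 - max (μ x) 0 with hh
    have h1 : (1 / (4 * ε ^ 2)) * h ^ 2 ≤ - (1/(2*ε^2)) * μ x * ‖v x‖^2
      + (1/(4*ε^2)) * ‖v x‖^4 + (1 / (4 * ε ^ 2)) * max (μ x) 0 ^ 2 := by
      have e : - (1/(2*ε^2)) * μ x * ‖v x‖^2
        + (1/(4*ε^2)) * ‖v x‖^4 + (1 / (4 * ε ^ 2)) * max (μ x) 0 ^ 2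
        = (1 / (4 * ε ^ 2)) * (‖v x‖ ^ 4 - 2 * μ x * ‖v x‖ ^ 2 + max (μ x) 0 ^ 2) := by
        field_simp; ring
      rw [e]
      gcongr
      rw [hh]
      have : μ x * ‖v x‖ ^ 2 ≤ max (μ x) 0 * ‖v x‖ ^ 2 := by
        gcongr; exact le_max_left _ _
      nlinarith
    have h2 : (inner ℝ (f x) (v x) : ℝ) ≤ ‖f x‖ * (1 + M + |h|) := by
      refine (real_inner_le_norm _ _).trans ?_
      gcongr
      have h3 : max (μ x) 0 ≤ M := max_le ((le_abs_self _).trans (hM x)) hM0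
      have h4 := le_abs_self h
      nlinarith [norm_nonneg (v x), sq_nonneg (‖v x‖ - 1)]
    have h3 : (a / ε) * (‖f x‖ * |h|) ≤ (1 / (8 * ε ^ 2)) * h ^ 2 + 2 * a ^ 2 * ‖f x‖ ^ 2 := by
      have e : (1 / (8 * ε ^ 2)) * h ^ 2 + 2 * a ^ 2 * ‖f x‖ ^ 2 - (a / ε) * (‖f x‖ * |h|)
        = (1 / (8 * ε ^ 2)) * (|h| - 4 * ε * a * ‖f x‖) ^ 2 := by
        rw [← sq_abs h]
        field_simp; ring
      have : 0 ≤ (1 / (8 * ε ^ 2)) * (|h| - 4 * ε * a * ‖f x‖) ^ 2 := by positivity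
      linarith
    have h4 : 2 * a ^ 2 * ‖f x‖ ^ 2 ≤ 2 * a ^ 2 * N * ‖f x‖ := by
      have := hN x
      have h0 := norm_nonneg (f x)
      calc 2 * a ^ 2 * ‖f x‖ ^ 2 = 2 * a ^ 2 * ‖f x‖ * ‖f x‖ := by ring
        _ ≤ _ := by gcongr
    have h5 : (a / ε) * (inner ℝ (f x) (v x) : ℝ) ≤ (a / ε) * (‖f x‖ * (1 + M + |h|)) := by gcongr
    have h6 : (1 / (4 * ε ^ 2)) * h ^ 2 = 2 * ((1 / (8 * ε ^ 2)) * h ^ 2) := by field_simp; ring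
    rw [hc]
    nlinarith
  have hi2 := (muP_integrable hμ).const_mul (1 / (4 * ε ^ 2))
  have hi3 := hf.integrable.norm.const_mul c
  have hR := (hint.add hi2).add hi3
  have hvc : Continuous v := hv.1.continuous
  have hμc := hμ.smooth.continuous
  have hh : Integrable (fun x => (1 / (8 * ε ^ 2)) * (‖v x‖ ^ 2 - max (μ x) 0) ^ 2) := by
    refine hR.mono' (by fun_prop) (Eventually.of_forall fun x => ?_)
    rw [Real.norm_of_nonneg (by positivity)]
    have h1 := hpt x
    have h2 := gradSq_nonneg v x
    simp only [Pi.add_apply]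
    linarith
  have hg := (gradSq_integrable hv).const_mul (1/2)
  have hh2 : Integrable (fun x => (‖v x‖ ^ 2 - max (μ x) 0) ^ 2) := by
    have := hh.const_mul (8 * ε ^ 2)
    refine this.congr (Eventually.of_forall fun x => ?_)
    simp only
    field_simp
  refine ⟨hh2, ?_⟩
  have hmono := integral_mono (hg.add hh) hR hpt
  rw [integral_add' hg hh, integral_add' (hint.add hi2) hi3, integral_add' hint hi2,
    integral_const_mul, integral_const_mul, integral_const_mul, integral_const_mul] at hmono
  refine hmono.trans ?_
  unfold energy
  have : c * Nf ≤ (1 + M + 2 * N) * Nf * (a / ε + a ^ 2) := by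
    rw [hc]
    have e1 : 0 ≤ a ^ 2 * (1 + M) * Nf := by positivity
    have e2 : 0 ≤ a / ε * (2 * N) * Nf := by positivity
    nlinarith
  linarith

lemma eps_ev : ∀ᶠ ε in 𝓝[>] (0:ℝ), 0 < ε ∧ ε ≤ 1 ∧ 1 ≤ |Real.log ε| := by
  have h1 : ∀ᶠ ε in 𝓝[>] (0:ℝ), ε ∈ Ioo 0 (Real.exp (-1)) :=
    Ioo_mem_nhdsGT (Real.exp_pos _)
  filter_upwards [h1] with ε hε
  have h2 : Real.log ε < -1 := by
    rw [Real.log_lt_iff_lt_exp hε.1]; exact hε.2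
  have h3 : Real.exp (-1) ≤ 1 := Real.exp_le_one_iff.mpr (by norm_num)
  refine ⟨hε.1, by linarith [hε.2], ?_⟩
  rw [abs_of_neg (by linarith)]; linarith

lemma eps_log : Tendsto (fun ε : ℝ => ε ^ 2 * |Real.log ε|) (𝓝[>] 0) (𝓝 0) := by
  have h := tendsto_log_mul_rpow_nhdsGT_zero (r := 2) (by norm_num)
  have h2 := h.abs
  rw [abs_zero] at h2
  refine h2.congr fun ε => ?_
  rw [Real.rpow_two, abs_mul, abs_of_nonneg (sq_nonneg ε), mul_comm]

lemma apriori (hμ : MuHyp μ μrad ρ) (hf : FHyp f frad)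
    (a : ℝ → ℝ) (ha0 : ∀ ε : ℝ, 0 < ε → 0 ≤ a ε)
    (hrat : ∃ C : ℝ, ∀ᶠ ε in 𝓝[>] (0:ℝ), a ε / (ε * |Real.log ε|) ≤ C)
    (v : ℝ → E2 → E2) (hv : ∀ ε : ℝ, 0 < ε → IsMinimizer ε (a ε) μ f (v ε)) :
    ∃ C ≥ 0, ∀ᶠ ε in 𝓝[>] (0:ℝ),
      Integrable (fun x => (‖v ε x‖ ^ 2 - max (μ x) 0) ^ 2) ∧
      (∫ x, gradSq (v ε) x) ≤ C * |Real.log ε| ∧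
      (∫ x, (‖v ε x‖ ^ 2 - max (μ x) 0) ^ 2) ≤ C * (ε ^ 2 * |Real.log ε|) := by
  obtain ⟨C0, hC0⟩ := hrat
  obtain ⟨C1, hC1, htest⟩ := testMap_energy hμ hf
  obtain ⟨C2, hC2, hlow⟩ := energy_lower hμ hf
  set B := ∫ x, max (μ x) 0 ^ 2 with hB
  have hBpos : 0 < B := muP_pos hμ
  set A := |C0| with hA
  have hA0 : 0 ≤ A := abs_nonneg _
  set K := C1 * (2 + A) with hK
  have hK0 : 0 ≤ K := by positivity
  set K2 := K + C2 * (A + A ^ 2) with hK2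
  have hK20 : 0 ≤ K2 := by positivity
  refine ⟨8 * K2, by positivity, ?_⟩
  have hsmall : ∀ᶠ ε in 𝓝[>] (0:ℝ), 4 * K * (ε ^ 2 * |Real.log ε|) < B := by
    have := (eps_log.const_mul (4 * K))
    rw [mul_zero] at this
    exact this.eventually (gt_mem_nhds hBpos)
  have hsmall2 : ∀ᶠ ε in 𝓝[>] (0:ℝ), ε ^ 2 * |Real.log ε| < 1 :=
    eps_log.eventually (gt_mem_nhds one_pos)
  filter_upwards [eps_ev, hC0, hsmall, hsmall2] with ε ⟨hε, hε1, hl1⟩ hrε hsm hsm2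
  set l := |Real.log ε| with hl
  have haε := ha0 ε hε
  have ha1 : a ε ≤ A * (ε * l) := by
    rw [div_le_iff₀ (by positivity)] at hrε
    exact hrε.trans (by gcongr; exact le_abs_self _)
  have ha2 : a ε / ε ≤ A * l := by
    rw [div_le_iff₀ hε]; linarith
  have ha3 : a ε ^ 2 ≤ A ^ 2 * l := by
    calc a ε ^ 2 ≤ (A * (ε * l)) ^ 2 := by gcongr
      _ = A ^ 2 * l * (ε ^ 2 * l) := by ring
      _ ≤ A ^ 2 * l * 1 := by gcongr
      _ = _ := by ring
  obtain ⟨hmem, hmin⟩ := hv ε hε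
  have h1 := (hmin _ (testMap_memH1 hμ hε)).trans (htest ε (a ε) hε hε1 haε)
  have h2 : C1 * (1 + l + a ε / ε) ≤ K * l := by
    rw [hK]
    have : 1 + l + a ε / ε ≤ (2 + A) * l := by nlinarith
    calc _ ≤ C1 * ((2 + A) * l) := by gcongr
      _ = _ := by ring
  have hneg : energy ε (a ε) μ f (v ε) < 0 := by
    have : K * l < (1 / (4 * ε ^ 2)) * B := by
      rw [one_div, inv_mul_eq_div, lt_div_iff₀ (by positivity)]
      linarith
    linarith
  obtain ⟨h3, h4⟩ := hlow ε (a ε) (v ε) hε haε hmem hneg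
  have h5 : C2 * (a ε / ε + a ε ^ 2) ≤ C2 * (A + A ^ 2) * l := by
    calc _ ≤ C2 * (A * l + A ^ 2 * l) := by gcongr
      _ = _ := by ring
  have h6 : (1 / 2) * (∫ x, gradSq (v ε) x) + (1 / (8 * ε ^ 2)) *
      (∫ x, (‖v ε x‖ ^ 2 - max (μ x) 0) ^ 2) ≤ K2 * l := by
    rw [hK2]; linarith
  have h7 : 0 ≤ ∫ x, gradSq (v ε) x := integral_nonneg fun x => gradSq_nonneg _ x
  have h8 : 0 ≤ ∫ x, (‖v ε x‖ ^ 2 - max (μ x) 0) ^ 2 := integral_nonneg fun x => by positivity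
  have h9 : 0 ≤ (1 / (8 * ε ^ 2)) * (∫ x, (‖v ε x‖ ^ 2 - max (μ x) 0) ^ 2) := by positivity
  refine ⟨h3, ?_, ?_⟩
  · have : 0 ≤ K2 * l := by positivity
    linarith
  · have h10 : (1 / (8 * ε ^ 2)) * (∫ x, (‖v ε x‖ ^ 2 - max (μ x) 0) ^ 2) ≤ K2 * l := by linarith
    rw [one_div, inv_mul_eq_div, div_le_iff₀ (by positivity)] at h10
    linarith

end apriori

lemma maxpow_hasDerivAt (n : ℕ) (x : ℝ) :
    HasDerivAt (fun y : ℝ => max y 0 ^ (n + 2)) ((n + 2 : ℝ) * max x 0 ^ (n + 1)) x := by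
  rcases lt_trichotomy x 0 with h | h | h
  · rw [max_eq_right h.le]
    refine ((hasDerivAt_const x (0:ℝ)).congr_of_eventuallyEq ?_).congr_deriv (by simp)
    filter_upwards [gt_mem_nhds h] with y hy
    simp [max_eq_right hy.le]
  · subst h
    simp only [max_self]
    rw [zero_pow (by omega), mul_zero, hasDerivAt_iff_isLittleO_nhds_zero]
    have h2 : (fun h : ℝ => max (0 + h) 0 ^ (n + 2) - max (0:ℝ) 0 ^ (n + 2) - h • (0:ℝ))
        =O[𝓝 0] fun h : ℝ => h ^ (n + 2) := by
      refine Asymptotics.IsBigO.of_bound 1 (Eventually.of_forall fun y => ?_)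
      simp only [zero_add, max_self, smul_zero, sub_zero, one_mul]
      rw [zero_pow (by omega), sub_zero, norm_pow, norm_pow]
      gcongr
      rw [Real.norm_of_nonneg (le_max_right _ _), Real.norm_eq_abs]
      exact max_le (le_abs_self y) (abs_nonneg y)
    have h3 : (fun h : ℝ => h ^ (n + 2)) =o[𝓝 0] fun h : ℝ => h := by
      simpa using Asymptotics.isLittleO_pow_pow (𝕜 := ℝ) (m := 1) (n := n + 2) (by omega)
    exact h2.trans_isLittleO h3
  · rw [max_eq_left h.le]
    refine ((hasDerivAt_pow (n + 2) x).congr_of_eventuallyEq ?_).congr_deriv (by simp)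
    filter_upwards [lt_mem_nhds h] with y hy
    simp [max_eq_left hy.le]

/-- The radial profile of the calibrating field. -/
def gam (T δ τ : ℝ) : ℝ := max τ 0 ^ 3 * max (1 - τ / T) 0 ^ 2 / (τ ^ 2 + δ ^ 2) ^ 2

/-- Its derivative. -/
def gam' (T δ τ : ℝ) : ℝ :=
  (3 * max τ 0 ^ 2 * max (1 - τ / T) 0 ^ 2 - 2 * max τ 0 ^ 3 * max (1 - τ / T) 0 / T)
      / (τ ^ 2 + δ ^ 2) ^ 2
    - 4 * τ * (max τ 0 ^ 3 * max (1 - τ / T) 0 ^ 2) / (τ ^ 2 + δ ^ 2) ^ 3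

lemma gam_continuous {T δ : ℝ} (hδ : 0 < δ) : Continuous (gam T δ) := by
  unfold gam
  exact Continuous.div (by fun_prop) (by fun_prop) fun τ => by positivity

lemma gam'_continuous {T δ : ℝ} (hδ : 0 < δ) : Continuous (gam' T δ) := by
  unfold gam'
  refine Continuous.sub ?_ ?_
  · exact Continuous.div (by fun_prop) (by fun_prop) fun τ => by positivity
  · exact Continuous.div (by fun_prop) (by fun_prop) fun τ => by positivity

lemma gam_hasDerivAt {T δ : ℝ} (hδ : 0 < δ) (τ : ℝ) :
    HasDerivAt (gam T δ) (gam' T δ τ) τ := by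
  have h1 : HasDerivAt (fun y : ℝ => max y 0 ^ 3) (3 * max τ 0 ^ 2) τ := by
    have := maxpow_hasDerivAt 1 τ
    norm_num at this
    exact this
  have h2 : HasDerivAt (fun y : ℝ => max (1 - y / T) 0 ^ 2)
      (2 * max (1 - τ / T) 0 * (-(1 / T))) τ := by
    have h0 : HasDerivAt (fun y : ℝ => 1 - y / T) (-(1 / T)) τ :=
      ((hasDerivAt_id τ).div_const T).const_sub 1
    have h3 := maxpow_hasDerivAt 0 (1 - τ / T)
    norm_num at h3
    exact h3.comp τ h0
  have h4 : HasDerivAt (fun y : ℝ => (y ^ 2 + δ ^ 2) ^ 2)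
      (2 * (τ ^ 2 + δ ^ 2) * (2 * τ)) τ := by
    have h0 : HasDerivAt (fun y : ℝ => y ^ 2 + δ ^ 2) (2 * τ) τ := by
      simpa using (hasDerivAt_pow 2 τ).add_const (δ ^ 2)
    exact (h0.fun_pow 2).congr_deriv (by simp)
  have hD : τ ^ 2 + δ ^ 2 ≠ 0 := by positivity
  refine ((h1.mul h2).div h4 (pow_ne_zero 2 hD)).congr_deriv ?_
  unfold gam'
  simp only [Pi.mul_apply]
  generalize max τ 0 = p
  generalize max (1 - τ / T) 0 = b
  generalize hDD : τ ^ 2 + δ ^ 2 = D at *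
  have : 2 * p ^ 3 * b / T = 2 * p ^ 3 * b * (1 / T) := by ring
  rw [this]
  generalize 1 / T = t
  field_simp
  ring

lemma gam_zero {T δ τ : ℝ} (hT : 0 < T) (h : τ ≤ 0 ∨ T ≤ τ) :
    gam T δ τ = 0 ∧ gam' T δ τ = 0 := by
  rcases h with h | h
  · simp [gam, gam', max_eq_right h]
  · have : 1 - τ / T ≤ 0 := by rw [sub_nonpos, one_le_div hT]; exact h
    simp [gam, gam', max_eq_right this]

section gambounds
variable {T δ τ : ℝ}


lemma gam_formula (hδ : 0 < δ) (h0 : 0 ≤ τ) (hT : 0 < T) (h1 : τ ≤ T) :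
    ∃ b : ℝ, b = 1 - τ / T ∧ 0 ≤ b ∧ b ≤ 1 ∧ gam T δ τ = τ ^ 3 * b ^ 2 / (τ ^ 2 + δ ^ 2) ^ 2 ∧
    gam' T δ τ = (3 * τ ^ 2 * b ^ 2 - 2 * τ ^ 3 * b / T) / (τ ^ 2 + δ ^ 2) ^ 2
      - 4 * τ * (τ ^ 3 * b ^ 2) / (τ ^ 2 + δ ^ 2) ^ 3 := by
  have hb : 0 ≤ 1 - τ / T := by rw [sub_nonneg, div_le_one hT]; exact h1
  have : 0 ≤ τ / T := by positivity
  refine ⟨1 - τ / T, rfl, hb, by linarith, ?_, ?_⟩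
  · simp only [gam, max_eq_left h0, max_eq_left hb]
  · simp only [gam', max_eq_left h0, max_eq_left hb]

lemma gam_nonneg (hδ : 0 < δ) (h0 : 0 ≤ τ) (hT : 0 < T) (h1 : τ ≤ T) : 0 ≤ gam T δ τ := by
  obtain ⟨b, -, hb0, hb1, hg, -⟩ := gam_formula hδ h0 hT h1
  rw [hg]; positivity

lemma gam_mul_le (hδ : 0 < δ) (h0 : 0 ≤ τ) (hT : 0 < T) (h1 : τ ≤ T) : gam T δ τ * τ ≤ 1 := by
  obtain ⟨b, -, hb0, hb1, hg, -⟩ := gam_formula hδ h0 hT h1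
  rw [hg, div_mul_eq_mul_div, div_le_one (by positivity)]
  have hb2 : b ^ 2 ≤ 1 := pow_le_one₀ hb0 hb1
  calc τ ^ 3 * b ^ 2 * τ ≤ τ ^ 3 * 1 * τ := by gcongr
    _ = (τ ^ 2) ^ 2 := by ring
    _ ≤ _ := by gcongr; nlinarith

lemma gam_ge (hδ : 0 < δ) (h0 : 0 ≤ τ) (hT : 0 < T) (h1 : τ ≤ T) : τ ^ 3 / (τ ^ 2 + δ ^ 2) ^ 2 - 2 / T ≤ gam T δ τ := by
  obtain ⟨b, hb, hb0, hb1, hg, -⟩ := gam_formula hδ h0 hT h1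
  rw [hg]
  have hD : 0 < (τ ^ 2 + δ ^ 2) ^ 2 := by positivity
  have e1 : 1 - 2 * (τ / T) ≤ b ^ 2 := by rw [hb]; nlinarith [sq_nonneg (τ / T)]
  have e2 : τ ^ 4 / (τ ^ 2 + δ ^ 2) ^ 2 ≤ 1 := by
    rw [div_le_one hD]; nlinarith [sq_nonneg (τ * δ), sq_nonneg (δ ^ 2)]
  calc τ ^ 3 / (τ ^ 2 + δ ^ 2) ^ 2 - 2 / T
      ≤ τ ^ 3 / (τ ^ 2 + δ ^ 2) ^ 2 - 2 / T * (τ ^ 4 / (τ ^ 2 + δ ^ 2) ^ 2) := by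
        have : 2 / T * (τ ^ 4 / (τ ^ 2 + δ ^ 2) ^ 2) ≤ 2 / T * 1 := by gcongr
        linarith
    _ = τ ^ 3 * (1 - 2 * (τ / T)) / (τ ^ 2 + δ ^ 2) ^ 2 := by field_simp
    _ ≤ _ := by gcongr

lemma gam_le (hδ : 0 < δ) (h0 : 0 ≤ τ) (hT : 0 < T) (h1 : τ ≤ T) : gam T δ τ ≤ T / (τ ^ 2 + δ ^ 2) := by
  obtain ⟨b, -, hb0, hb1, hg, -⟩ := gam_formula hδ h0 hT h1
  have hD : 0 < τ ^ 2 + δ ^ 2 := by positivity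
  have hb2 : b ^ 2 ≤ 1 := pow_le_one₀ hb0 hb1
  rw [hg, div_le_div_iff₀ (by positivity) hD]
  calc τ ^ 3 * b ^ 2 * (τ ^ 2 + δ ^ 2) = τ * τ ^ 2 * b ^ 2 * (τ ^ 2 + δ ^ 2) := by ring
    _ ≤ T * (τ ^ 2 + δ ^ 2) * 1 * (τ ^ 2 + δ ^ 2) := by gcongr; nlinarith
    _ = _ := by ring

lemma gam_sq_le (hδ : 0 < δ) (h0 : 0 ≤ τ) (hT : 0 < T) (h1 : τ ≤ T) : gam T δ τ ^ 2 ≤ 1 / (τ ^ 2 + δ ^ 2) := by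
  obtain ⟨b, -, hb0, hb1, hg, -⟩ := gam_formula hδ h0 hT h1
  have hD : 0 < τ ^ 2 + δ ^ 2 := by positivity
  have hb2 : b ^ 2 ≤ 1 := pow_le_one₀ hb0 hb1
  rw [hg, div_pow, div_le_div_iff₀ (by positivity) hD]
  calc (τ ^ 3 * b ^ 2) ^ 2 * (τ ^ 2 + δ ^ 2) = (τ ^ 2) ^ 3 * (b ^ 2) ^ 2 * (τ ^ 2 + δ ^ 2) := by ring
    _ ≤ (τ ^ 2 + δ ^ 2) ^ 3 * 1 ^ 2 * (τ ^ 2 + δ ^ 2) := by gcongr; nlinarith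
    _ = _ := by ring

lemma gam'_le (hδ : 0 < δ) (h0 : 0 ≤ τ) (hT : 0 < T) (h1 : τ ≤ T) : |gam' T δ τ| ≤ 9 / (τ ^ 2 + δ ^ 2) := by
  obtain ⟨b, -, hb0, hb1, -, hg⟩ := gam_formula hδ h0 hT h1
  have hD : 0 < τ ^ 2 + δ ^ 2 := by positivity
  have hb2 : b ^ 2 ≤ 1 := pow_le_one₀ hb0 hb1
  have hτT : τ / T ≤ 1 := (div_le_one hT).mpr h1
  have hτT0 : 0 ≤ τ / T := by positivity
  set D := τ ^ 2 + δ ^ 2 with hDD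
  have hτD : τ ^ 2 ≤ D := by rw [hDD]; nlinarith
  have e : gam' T δ τ = 3 * (τ ^ 2 * b ^ 2 / D ^ 2) - 2 * (τ ^ 2 * b * (τ / T) / D ^ 2)
      - 4 * ((τ ^ 2) ^ 2 * b ^ 2 / D ^ 3) := by
    rw [hg]; field_simp
  have a1 : τ ^ 2 * b ^ 2 / D ^ 2 ≤ 1 / D := by
    rw [div_le_div_iff₀ (by positivity) hD]
    calc τ ^ 2 * b ^ 2 * D ≤ D * 1 * D := by gcongr
      _ = _ := by ring
  have a2 : τ ^ 2 * b * (τ / T) / D ^ 2 ≤ 1 / D := by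
    rw [div_le_div_iff₀ (by positivity) hD]
    calc τ ^ 2 * b * (τ / T) * D ≤ D * 1 * 1 * D := by gcongr
      _ = _ := by ring
  have a3 : (τ ^ 2) ^ 2 * b ^ 2 / D ^ 3 ≤ 1 / D := by
    rw [div_le_div_iff₀ (by positivity) hD]
    calc (τ ^ 2) ^ 2 * b ^ 2 * D ≤ D ^ 2 * 1 * D := by gcongr
      _ = _ := by ring
  have b1 : 0 ≤ τ ^ 2 * b ^ 2 / D ^ 2 := by positivity
  have b2 : 0 ≤ τ ^ 2 * b * (τ / T) / D ^ 2 := by positivity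
  have b3 : 0 ≤ (τ ^ 2) ^ 2 * b ^ 2 / D ^ 3 := by positivity
  have c1 : 0 ≤ 1 / D := by positivity
  have c2 : 9 / D = 9 * (1 / D) := by ring
  rw [e, c2, abs_le]
  constructor <;> linarith

end gambounds

lemma int_main {T δ : ℝ} (hT : 0 < T) (hδ : 0 < δ) :
    Real.log T - Real.log δ - 1 / 2 ≤ ∫ τ in (0:ℝ)..T, τ ^ 3 / (τ ^ 2 + δ ^ 2) ^ 2 := by
  have h : ∀ τ ∈ uIcc 0 T, HasDerivAt
      (fun τ : ℝ => (1/2) * (Real.log (τ ^ 2 + δ ^ 2) + δ ^ 2 / (τ ^ 2 + δ ^ 2)))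
      (τ ^ 3 / (τ ^ 2 + δ ^ 2) ^ 2) τ := by
    intro τ _
    have hD : τ ^ 2 + δ ^ 2 ≠ 0 := by positivity
    have h0 : HasDerivAt (fun y : ℝ => y ^ 2 + δ ^ 2) (2 * τ) τ := by
      simpa using (hasDerivAt_pow 2 τ).add_const (δ ^ 2)
    refine (((h0.log hD).add ((hasDerivAt_const τ (δ ^ 2)).div h0 hD)).const_mul (1/2)).congr_deriv ?_
    field_simp; ring
  rw [intervalIntegral.integral_eq_sub_of_hasDerivAt h]
  · have e1 : Real.log (T ^ 2) ≤ Real.log (T ^ 2 + δ ^ 2) := by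
      apply Real.log_le_log (by positivity); nlinarith
    have e2 : 0 ≤ δ ^ 2 / (T ^ 2 + δ ^ 2) := by positivity
    have e3 : δ ^ 2 / ((0:ℝ) ^ 2 + δ ^ 2) = 1 := by
      rw [zero_pow (by norm_num), zero_add, div_self (by positivity)]
    rw [e3]
    rw [Real.log_pow] at e1
    have e4 : Real.log ((0:ℝ) ^ 2 + δ ^ 2) = 2 * Real.log δ := by
      rw [zero_pow (by norm_num), zero_add, Real.log_pow]; norm_num
    rw [e4]
    push_cast at e1
    linarith
  · apply Continuous.intervalIntegrable
    exact Continuous.div (by fun_prop) (by fun_prop) fun τ => by positivity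

lemma int_err {T δ : ℝ} (hT : 0 < T) (hδ : 0 < δ) :
    ∫ τ in (0:ℝ)..T, 1 / (τ ^ 2 + δ ^ 2) ^ 2 ≤ 4 / δ ^ 3 := by
  have h : ∀ τ ∈ uIcc 0 T, HasDerivAt (fun τ : ℝ => -(4 / 3) * ((τ + δ) ^ 3)⁻¹)
      (4 / (τ + δ) ^ 4) τ := by
    intro τ hτ
    rw [uIcc_of_le hT.le] at hτ
    have hp : 0 < τ + δ := by linarith [hτ.1]
    have h0 : HasDerivAt (fun y : ℝ => (y + δ) ^ 3) (3 * (τ + δ) ^ 2) τ := by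
      exact (((hasDerivAt_id τ).add_const δ).fun_pow 3).congr_deriv (by simp)
    refine ((h0.inv (by positivity)).const_mul (-(4/3))).congr_deriv ?_
    field_simp; try norm_num
  have hci : IntervalIntegrable (fun τ : ℝ => 4 / (τ + δ) ^ 4) volume 0 T := by
    apply ContinuousOn.intervalIntegrable
    apply ContinuousOn.div continuousOn_const (by fun_prop)
    intro τ hτ
    rw [uIcc_of_le hT.le] at hτ
    have hp : 0 < τ + δ := by linarith [hτ.1]
    positivity
  calc ∫ τ in (0:ℝ)..T, 1 / (τ ^ 2 + δ ^ 2) ^ 2 ≤ ∫ τ in (0:ℝ)..T, 4 / (τ + δ) ^ 4 := by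
        refine intervalIntegral.integral_mono_on hT.le ?_ hci ?_
        · apply Continuous.intervalIntegrable
          exact Continuous.div (by fun_prop) (by fun_prop) fun τ => by positivity
        · intro τ hτ
          have hp : 0 < τ + δ := by linarith [hτ.1]
          rw [div_le_div_iff₀ (by positivity) (by positivity)]
          have : (τ + δ) ^ 2 ≤ 2 * (τ ^ 2 + δ ^ 2) := by nlinarith [sq_nonneg (τ - δ)]
          calc 1 * (τ + δ) ^ 4 = ((τ + δ) ^ 2) ^ 2 := by ring
            _ ≤ (2 * (τ ^ 2 + δ ^ 2)) ^ 2 := by gcongr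
            _ = _ := by ring
    _ = -(4 / 3) * ((T + δ) ^ 3)⁻¹ - -(4 / 3) * ((0 + δ) ^ 3)⁻¹ :=
        intervalIntegral.integral_eq_sub_of_hasDerivAt h hci
    _ ≤ 4 / δ ^ 3 := by
        have e1 : 0 ≤ ((T + δ) ^ 3)⁻¹ := by positivity
        have e2 : 0 ≤ (δ ^ 3)⁻¹ := by positivity
        have e3 : 4 / δ ^ 3 = 4 * (δ ^ 3)⁻¹ := by ring
        rw [zero_add, e3]
        linarith

/-- Components of the calibrating vector field. -/
def Gf (ρ T δ : ℝ) (i : Fin 2) (x : E2) : ℝ := - gam T δ (ρ ^ 2 - ‖x‖ ^ 2) * x i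

lemma inner_e2basis (x : E2) (i : Fin 2) : (inner ℝ x (e2basis i) : ℝ) = x i := by
  simp [e2basis, EuclideanSpace.inner_single_right]

lemma e2basis_apply (i : Fin 2) : (e2basis i) i = 1 := by simp [e2basis]

lemma Gf_hasFDerivAt {T δ : ℝ} (hδ : 0 < δ) (ρ : ℝ) (i : Fin 2) (x : E2) :
    ∃ L : E2 →L[ℝ] ℝ, HasFDerivAt (Gf ρ T δ i) L x ∧
      L (e2basis i) = - gam T δ (ρ ^ 2 - ‖x‖ ^ 2) + 2 * gam' T δ (ρ ^ 2 - ‖x‖ ^ 2) * x i ^ 2 := by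
  have h1 : HasFDerivAt (fun y : E2 => ρ ^ 2 - ‖y‖ ^ 2) (-((2:ℝ) • innerSL ℝ x)) x := by
    have := (hasStrictFDerivAt_norm_sq x).hasFDerivAt.const_sub (ρ ^ 2)
    refine this.congr_fderiv ?_
    ext y; simp
  have h2 := ((gam_hasDerivAt (T := T) hδ (ρ ^ 2 - ‖x‖ ^ 2)).comp_hasFDerivAt x h1).neg
  have h3 : HasFDerivAt (fun y : E2 => y i) (EuclideanSpace.proj i : E2 →L[ℝ] ℝ) x :=
    (EuclideanSpace.proj i : E2 →L[ℝ] ℝ).hasFDerivAt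
  refine ⟨_, h2.mul h3, ?_⟩
  simp [inner_e2basis, e2basis_apply]
  ring

lemma Gf_differentiable {T δ : ℝ} (hδ : 0 < δ) (ρ : ℝ) (i : Fin 2) :
    Differentiable ℝ (Gf ρ T δ i) := fun x =>
  let ⟨_, h, _⟩ := Gf_hasFDerivAt hδ ρ i x
  h.differentiableAt

lemma Gf_fderiv {T δ : ℝ} (hδ : 0 < δ) (ρ : ℝ) (i : Fin 2) (x : E2) :
    fderiv ℝ (Gf ρ T δ i) x (e2basis i) =
      - gam T δ (ρ ^ 2 - ‖x‖ ^ 2) + 2 * gam' T δ (ρ ^ 2 - ‖x‖ ^ 2) * x i ^ 2 := by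
  obtain ⟨L, h, hL⟩ := Gf_hasFDerivAt (T := T) hδ ρ i x
  rw [h.fderiv, hL]

lemma gam_ann_zero {ρ T δ : ℝ} (hT : 0 < T) {x : E2} (hx : x ∉ ann ρ T) :
    gam T δ (ρ ^ 2 - ‖x‖ ^ 2) = 0 ∧ gam' T δ (ρ ^ 2 - ‖x‖ ^ 2) = 0 := by
  apply gam_zero hT
  by_contra h
  push Not at h
  exact hx ⟨by linarith, by linarith⟩

lemma cs_ann {ρ T : ℝ} {g : E2 → ℝ} (hg : ∀ x, x ∉ ann ρ T → g x = 0) : HasCompactSupport g :=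
  HasCompactSupport.intro (ann_compact ρ T) fun x hx => hg x hx

lemma sum_sq (x : E2) : x 0 ^ 2 + x 1 ^ 2 = ‖x‖ ^ 2 := by
  rw [EuclideanSpace.norm_sq_eq, Fin.sum_univ_two]; simp

lemma basis_decomp (x : E2) : x = x 0 • e2basis 0 + x 1 • e2basis 1 := by
  ext i; fin_cases i <;> simp [e2basis]

section field
variable {μ : E2 → ℝ} {μrad : ℝ → ℝ} {ρ : ℝ}

lemma h_hasFDerivAt (hμ : MuHyp μ μrad ρ) {v : E2 → E2} (hv : Differentiable ℝ v) (x : E2)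
    (i : Fin 2) :
    fderiv ℝ (fun y => ‖v y‖ ^ 2 - μ y) x (e2basis i) =
      2 * (inner ℝ (v x) (fderiv ℝ v x (e2basis i)) : ℝ) - fderiv ℝ μ x (e2basis i) := by
  have h := ((hv x).hasFDerivAt.norm_sq).sub (mu_differentiable hμ x).hasFDerivAt
  have h' : HasFDerivAt (fun y => ‖v y‖ ^ 2 - μ y) _ x := h
  rw [h'.fderiv]
  simp

/-- The divergence-type coefficient of the error term. -/
def Qf (ρ T δ : ℝ) (x : E2) : ℝ :=
  -2 * gam T δ (ρ ^ 2 - ‖x‖ ^ 2) + 2 * gam' T δ (ρ ^ 2 - ‖x‖ ^ 2) * ‖x‖ ^ 2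
    + gam T δ (ρ ^ 2 - ‖x‖ ^ 2) ^ 2 * ‖x‖ ^ 2

/-- The main term. -/
def Kf (μ : E2 → ℝ) (ρ T δ : ℝ) (x : E2) : ℝ :=
  - gam T δ (ρ ^ 2 - ‖x‖ ^ 2) * fderiv ℝ μ x x - gam T δ (ρ ^ 2 - ‖x‖ ^ 2) ^ 2 * ‖x‖ ^ 2 * μ x

lemma calib_pointwise (hμ : MuHyp μ μrad ρ) {v : E2 → E2} (hv : Differentiable ℝ v)
    (T δ : ℝ) (x : E2) :
    (∑ i : Fin 2, Gf ρ T δ i x * fderiv ℝ (fun y => ‖v y‖ ^ 2 - μ y) x (e2basis i))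
      + Kf μ ρ T δ x - gam T δ (ρ ^ 2 - ‖x‖ ^ 2) ^ 2 * ‖x‖ ^ 2 * (‖v x‖ ^ 2 - μ x)
      ≤ gradSq v x := by
  have hi : ∀ i : Fin 2, 2 * Gf ρ T δ i x * (inner ℝ (v x) (fderiv ℝ v x (e2basis i)) : ℝ)
      - Gf ρ T δ i x ^ 2 * ‖v x‖ ^ 2 ≤ ‖fderiv ℝ v x (e2basis i)‖ ^ 2 := by
    intro i
    have h := sq_nonneg (‖fderiv ℝ v x (e2basis i) - Gf ρ T δ i x • v x‖)
    rw [norm_sub_sq_real, inner_smul_right, norm_smul, real_inner_comm, mul_pow,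
      Real.norm_eq_abs, sq_abs] at h
    linarith
  have hK : fderiv ℝ μ x x = x 0 * fderiv ℝ μ x (e2basis 0) + x 1 * fderiv ℝ μ x (e2basis 1) := by
    conv_lhs => rw [basis_decomp x, map_add, map_smul, map_smul]
    rw [← basis_decomp x]
    simp
  unfold gradSq Kf
  rw [Fin.sum_univ_two, Fin.sum_univ_two, h_hasFDerivAt hμ hv, h_hasFDerivAt hμ hv, hK]
  have h0 := hi 0
  have h1 := hi 1
  unfold Gf at *
  have hs := sum_sq x
  generalize gam T δ (ρ ^ 2 - ‖x‖ ^ 2) = g at *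
  rw [← hs]
  linarith

lemma calib_integral (hμ : MuHyp μ μrad ρ) {v : E2 → E2} (hv : MemH1 v)
    {T δ : ℝ} (hT : 0 < T) (hδ : 0 < δ) :
    (∫ x in ann ρ T, Kf μ ρ T δ x) - (∫ x in ann ρ T, Qf ρ T δ x * (‖v x‖ ^ 2 - μ x))
      ≤ ∫ x in ann ρ T, gradSq v x := by
  have hvc : Continuous v := hv.1.continuous
  have hμc := hμ.smooth.continuous
  have hμd := fderiv_mu_continuous hμ
  have hc : Continuous fun x : E2 => gam T δ (ρ ^ 2 - ‖x‖ ^ 2) :=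
    (gam_continuous hδ).comp (by fun_prop)
  have hc' : Continuous fun x : E2 => gam' T δ (ρ ^ 2 - ‖x‖ ^ 2) :=
    (gam'_continuous hδ).comp (by fun_prop)
  have hG : ∀ i, Continuous (Gf ρ T δ i) := fun i => (Gf_differentiable hδ ρ i).continuous
  set h : E2 → ℝ := fun y => ‖v y‖ ^ 2 - μ y with hh
  have hhd : Differentiable ℝ h := fun x =>
    ((hv.1 x).norm_sq ℝ).sub (mu_differentiable hμ x)
  have hhc := hhd.continuous
  -- integrability
  have i1 : ∀ i, Integrable fun x => fderiv ℝ (Gf ρ T δ i) x (e2basis i) * h x := by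
    intro i
    refine Continuous.integrable_of_hasCompactSupport ?_ (cs_ann (ρ := ρ) (T := T) fun x hx => ?_)
    · simp only [Gf_fderiv hδ]
      fun_prop
    · rw [Gf_fderiv hδ, (gam_ann_zero hT hx).1, (gam_ann_zero hT hx).2]; simp
  have Gz : ∀ i x, x ∉ ann ρ T → Gf ρ T δ i x = 0 := by
    intro i x hx
    simp [Gf, (gam_ann_zero hT hx).1]
  have i2 : ∀ i, Integrable fun x => Gf ρ T δ i x * h x := by
    intro i
    refine Continuous.integrable_of_hasCompactSupport ((hG i).mul hhc)
      (cs_ann (ρ := ρ) (T := T) fun x hx => ?_)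
    rw [Gz i x hx, zero_mul]
  have i3 : ∀ i, Integrable fun x => Gf ρ T δ i x * fderiv ℝ h x (e2basis i) := by
    intro i
    have ha : Integrable fun x => Gf ρ T δ i x * fderiv ℝ μ x (e2basis i) := by
      refine Continuous.integrable_of_hasCompactSupport
        ((hG i).mul (hμd.clm_apply continuous_const))
        (cs_ann (ρ := ρ) (T := T) fun x hx => ?_)
      rw [Gz i x hx, zero_mul]
    have hb : Integrable fun x => Gf ρ T δ i x ^ 2 * ‖v x‖ ^ 2 := by
      have := hG i
      refine Continuous.integrable_of_hasCompactSupport (by fun_prop)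
        (cs_ann (ρ := ρ) (T := T) fun x hx => ?_)
      rw [Gz i x hx]; simp
    have hd := memLp_partial hv i
    have hcc : Integrable fun x => Gf ρ T δ i x *
        (2 * (inner ℝ (v x) (fderiv ℝ v x (e2basis i)) : ℝ)) := by
      refine (hb.add (hd.integrable_norm_pow (by norm_num))).mono' ?_
        (Eventually.of_forall fun x => ?_)
      · exact (hG i).aestronglyMeasurable.mul
          ((hvc.aestronglyMeasurable.inner hd.1).const_mul 2)
      · simp only [Pi.add_apply]
        have e := abs_real_inner_le_norm (v x) (fderiv ℝ v x (e2basis i))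
        rw [norm_mul, norm_mul, Real.norm_eq_abs, Real.norm_eq_abs, Real.norm_eq_abs,
          ← sq_abs (Gf ρ T δ i x), abs_of_pos (show (0:ℝ) < 2 by norm_num)]
        have e2 : |Gf ρ T δ i x| * (2 * |(inner ℝ (v x) (fderiv ℝ v x (e2basis i)) : ℝ)|)
          ≤ |Gf ρ T δ i x| * (2 * (‖v x‖ * ‖fderiv ℝ v x (e2basis i)‖)) := by gcongr
        have e3 := sq_nonneg (|Gf ρ T δ i x| * ‖v x‖ - ‖fderiv ℝ v x (e2basis i)‖)
        nlinarith
    refine (hcc.sub ha).congr (Eventually.of_forall fun x => ?_)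
    simp only [Pi.sub_apply]
    rw [hh, h_hasFDerivAt hμ hv.1]; ring
  have ibp : ∀ i, ∫ x, Gf ρ T δ i x * fderiv ℝ h x (e2basis i)
      = - ∫ x, fderiv ℝ (Gf ρ T δ i) x (e2basis i) * h x := fun i =>
    integral_mul_fderiv_eq_neg_fderiv_mul_of_integrable (i1 i) (i3 i) (i2 i)
      (fun x _ => Gf_differentiable hδ ρ i x) (fun x _ => hhd x)
  have iK : Integrable (Kf μ ρ T δ) := by
    refine Continuous.integrable_of_hasCompactSupport ?_ (cs_ann (ρ := ρ) (T := T) fun x hx => ?_)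
    · unfold Kf
      have : Continuous fun x => fderiv ℝ μ x x := hμd.clm_apply continuous_id
      fun_prop
    · simp [Kf, (gam_ann_zero hT hx).1]
  have iR : Integrable fun x => gam T δ (ρ ^ 2 - ‖x‖ ^ 2) ^ 2 * ‖x‖ ^ 2 * h x := by
    refine Continuous.integrable_of_hasCompactSupport (by fun_prop)
      (cs_ann (ρ := ρ) (T := T) fun x hx => ?_)
    simp [(gam_ann_zero hT hx).1]
  have iS := ((i3 0).add (i3 1))
  have iAll := (iS.add iK).sub iR
  have hmono : ∫ x in ann ρ T, (((fun x => Gf ρ T δ 0 x * fderiv ℝ h x (e2basis 0)) +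
      (fun x => Gf ρ T δ 1 x * fderiv ℝ h x (e2basis 1)) + Kf μ ρ T δ -
      fun x => gam T δ (ρ ^ 2 - ‖x‖ ^ 2) ^ 2 * ‖x‖ ^ 2 * h x) : E2 → ℝ) x
      ≤ ∫ x in ann ρ T, gradSq v x := by
    refine setIntegral_mono iAll.integrableOn (gradSq_integrable hv).integrableOn fun x => ?_
    have := calib_pointwise hμ hv.1 T δ x
    rw [Fin.sum_univ_two] at this
    exact this
  rw [setIntegral_eq_integral_of_forall_compl_eq_zero, integral_sub' (iS.add iK) iR,
    integral_add' iS iK, integral_add' (i3 0) (i3 1), ibp 0, ibp 1] at hmono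
  swap
  · intro x hx
    simp [Gz _ x hx, Kf, (gam_ann_zero hT hx).1]
  refine le_trans (le_of_eq ?_) hmono
  rw [setIntegral_eq_integral_of_forall_compl_eq_zero, setIntegral_eq_integral_of_forall_compl_eq_zero]
  · have hQ : ∫ x, Qf ρ T δ x * (‖v x‖ ^ 2 - μ x) =
        (∫ x, fderiv ℝ (Gf ρ T δ 0) x (e2basis 0) * h x)
        + (∫ x, fderiv ℝ (Gf ρ T δ 1) x (e2basis 1) * h x)
        + ∫ x, gam T δ (ρ ^ 2 - ‖x‖ ^ 2) ^ 2 * ‖x‖ ^ 2 * h x := by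
      rw [← integral_add' (i1 0) (i1 1), ← integral_add' ((i1 0).add (i1 1)) iR]
      congr 1
      funext x
      simp only [Pi.add_apply, Gf_fderiv hδ, Qf, hh]
      rw [← sum_sq]; ring
    rw [hQ]; ring
  · intro x hx
    simp [Qf, (gam_ann_zero hT hx).1, (gam_ann_zero hT hx).2]
  · intro x hx
    simp [Kf, (gam_ann_zero hT hx).1]

end field

section lower
variable {μ : E2 → ℝ} {μrad : ℝ → ℝ} {ρ : ℝ}

lemma Kf_lower (hμ : MuHyp μ μrad ρ) {T : ℝ} (hT : 0 < T) :
    ∃ C : ℝ, ∀ δ > 0, ∀ x ∈ ann ρ T,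
      (ρ * |deriv μrad ρ| / 2) * ((ρ ^ 2 - ‖x‖ ^ 2) ^ 3 / ((ρ ^ 2 - ‖x‖ ^ 2) ^ 2 + δ ^ 2) ^ 2) - C
        ≤ Kf μ ρ T δ x := by
  obtain ⟨C, hC, h⟩ := mu_taylor hμ
  have hρ := hμ.rho_pos
  refine ⟨ρ * |deriv μrad ρ| / T + C + C * ρ ^ 2, fun δ hδ x hx => ?_⟩
  have hxρ : ‖x‖ ≤ ρ := abs_le_of_sq_le_sq' hx.2 hρ.le |>.2
  obtain ⟨h1, h2⟩ := h x hxρ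
  have hμ0 := mu_nonneg hμ hxρ
  have hτ0 : 0 ≤ ρ ^ 2 - ‖x‖ ^ 2 := by linarith [hx.2]
  have hτT : ρ ^ 2 - ‖x‖ ^ 2 ≤ T := by linarith [hx.1]
  have g0 := gam_nonneg hδ hτ0 hT hτT
  have g1 := gam_mul_le hδ hτ0 hT hτT
  have g2 := gam_ge hδ hτ0 hT hτT
  have hr : ‖x‖ ^ 2 ≤ ρ ^ 2 := hx.2
  unfold Kf
  set τ := ρ ^ 2 - ‖x‖ ^ 2 with hτ
  set m := |deriv μrad ρ|
  have hm : 0 ≤ m := abs_nonneg _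
  generalize gam T δ τ = g at *
  generalize τ ^ 3 / (τ ^ 2 + δ ^ 2) ^ 2 = P at *
  have a1 : g * (ρ * m - C * τ) ≤ g * (- fderiv ℝ μ x x) := mul_le_mul_of_nonneg_left h1 g0
  have a2 : C * (g * τ) ≤ C * 1 := mul_le_mul_of_nonneg_left g1 hC
  have a3 : g ^ 2 * ‖x‖ ^ 2 * μ x ≤ g ^ 2 * ρ ^ 2 * (m * τ / (2 * ρ) + C * τ ^ 2) := by
    gcongr
  have a4 : g ^ 2 * ρ ^ 2 * (m * τ / (2 * ρ) + C * τ ^ 2)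
      = (ρ * m / 2) * g * (g * τ) + C * ρ ^ 2 * (g * τ) ^ 2 := by
    field_simp
  have a5 : (ρ * m / 2) * g * (g * τ) ≤ (ρ * m / 2) * g * 1 :=
    mul_le_mul_of_nonneg_left g1 (by positivity)
  have a6 : C * ρ ^ 2 * (g * τ) ^ 2 ≤ C * ρ ^ 2 * 1 :=
    mul_le_mul_of_nonneg_left (pow_le_one₀ (by positivity) g1) (by positivity)
  have a7 : (ρ * m / 2) * (P - 2 / T) ≤ (ρ * m / 2) * g :=
    mul_le_mul_of_nonneg_left g2 (by positivity)
  have a8 : (ρ * m / 2) * (P - 2 / T) = (ρ * m / 2) * P - ρ * m / T := by ring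
  linarith

lemma Qf_upper {T δ : ℝ} (hT : 0 < T) (hδ : 0 < δ) {x : E2} (hx : x ∈ ann ρ T) :
    |Qf ρ T δ x| ≤ (2 * T + 19 * ρ ^ 2) / ((ρ ^ 2 - ‖x‖ ^ 2) ^ 2 + δ ^ 2) := by
  have hτ0 : 0 ≤ ρ ^ 2 - ‖x‖ ^ 2 := by linarith [hx.2]
  have hτT : ρ ^ 2 - ‖x‖ ^ 2 ≤ T := by linarith [hx.1]
  have g0 := gam_nonneg hδ hτ0 hT hτT
  have g1 := gam_le hδ hτ0 hT hτT
  have g2 := gam'_le hδ hτ0 hT hτT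
  have g3 := gam_sq_le hδ hτ0 hT hτT
  have hr : ‖x‖ ^ 2 ≤ ρ ^ 2 := hx.2
  unfold Qf
  set τ := ρ ^ 2 - ‖x‖ ^ 2 with hτ
  have hD : 0 < τ ^ 2 + δ ^ 2 := by positivity
  have e1 : |-2 * gam T δ τ| ≤ 2 * (T / (τ ^ 2 + δ ^ 2)) := by
    rw [abs_mul, abs_of_nonneg g0]; norm_num; exact g1
  have e2 : |2 * gam' T δ τ * ‖x‖ ^ 2| ≤ 2 * (9 / (τ ^ 2 + δ ^ 2)) * ρ ^ 2 := by
    rw [abs_mul, abs_mul, abs_of_nonneg (sq_nonneg ‖x‖), abs_of_pos (show (0:ℝ) < 2 by norm_num)]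
    gcongr
  have e3 : |gam T δ τ ^ 2 * ‖x‖ ^ 2| ≤ 1 / (τ ^ 2 + δ ^ 2) * ρ ^ 2 := by
    rw [abs_of_nonneg (by positivity)]
    gcongr
  calc _ ≤ _ := (abs_add_le _ _).trans (add_le_add_left (abs_add_le _ _) _)
    _ ≤ 2 * (T / (τ ^ 2 + δ ^ 2)) + 2 * (9 / (τ ^ 2 + δ ^ 2)) * ρ ^ 2
        + 1 / (τ ^ 2 + δ ^ 2) * ρ ^ 2 := by gcongr
    _ = _ := by ring

lemma lower_bound (hμ : MuHyp μ μrad ρ) {T : ℝ} (hT : 0 < T) (hTρ : T ≤ ρ ^ 2) :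
    ∃ C : ℝ, ∀ δ > 0, ∀ l > 0, ∀ v : E2 → E2, MemH1 v →
      Integrable (fun x => (‖v x‖ ^ 2 - max (μ x) 0) ^ 2) →
      π * (ρ * |deriv μrad ρ| / 2) * (-Real.log δ) - C - C * (l / δ ^ 3)
        - (∫ x, (‖v x‖ ^ 2 - max (μ x) 0) ^ 2) / l ≤ ∫ x in ann ρ T, gradSq v x := by
  obtain ⟨C, hC⟩ := Kf_lower hμ hT
  have hρ := hμ.rho_pos
  set m := |deriv μrad ρ| with hm_def
  have hm : 0 ≤ m := abs_nonneg _
  set Cd := 2 * T + 19 * ρ ^ 2 with hCd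
  set A := π * (ρ * m / 2) with hA
  have hA0 : 0 ≤ A := by positivity
  refine ⟨max (A * (1 / 2 - Real.log T) + π * (C * T)) (2 * π * Cd ^ 2),
    fun δ hδ l hl v hv hint => ?_⟩
  have hcal := calib_integral hμ hv hT hδ
  have hvc : Continuous v := hv.1.continuous
  have hμc := hμ.smooth.continuous
  have hμd := fderiv_mu_continuous hμ
  have hc : Continuous fun x : E2 => gam T δ (ρ ^ 2 - ‖x‖ ^ 2) :=
    (gam_continuous hδ).comp (by fun_prop)
  have hc' : Continuous fun x : E2 => gam' T δ (ρ ^ 2 - ‖x‖ ^ 2) :=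
    (gam'_continuous hδ).comp (by fun_prop)
  have hK : (A * (Real.log T - Real.log δ - 1 / 2) - π * (C * T)) ≤ ∫ x in ann ρ T, Kf μ ρ T δ x := by
    have iF : ContinuousOn (fun τ : ℝ => (ρ * m / 2) * (τ ^ 3 / (τ ^ 2 + δ ^ 2) ^ 2) - C)
        (Icc 0 T) := by
      refine Continuous.continuousOn ?_
      exact ((Continuous.div (by fun_prop) (by fun_prop) fun τ => by positivity).const_mul _).sub
        continuous_const
    have h1 := setIntegral_mono_on (ann_integrable ρ T _ iF) (g := Kf μ ρ T δ)
      (ContinuousOn.integrableOn_compact (ann_compact ρ T) (Continuous.continuousOn ?_)) (ann_meas ρ T) (hC δ hδ)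
    · rw [rad_ann ρ T hT.le hTρ (fun τ : ℝ => (ρ * m / 2) * (τ ^ 3 / (τ ^ 2 + δ ^ 2) ^ 2) - C)] at h1
      refine le_trans ?_ h1
      rw [intervalIntegral.integral_sub, intervalIntegral.integral_const_mul,
        intervalIntegral.integral_const]
      · have h2 := mul_le_mul_of_nonneg_left (int_main hT hδ) hA0
        simp only [sub_zero, smul_eq_mul]
        exact le_trans (sub_le_sub_right h2 _) (le_of_eq (by rw [hA]; ring))
      · refine Continuous.intervalIntegrable ?_ _ _
        exact ((Continuous.div (by fun_prop) (by fun_prop) fun τ => by positivity).const_mul _)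
      · exact intervalIntegrable_const
    · unfold Kf
      have : Continuous fun x => fderiv ℝ μ x x := hμd.clm_apply continuous_id
      fun_prop
  have hQ : (∫ x in ann ρ T, Qf ρ T δ x * (‖v x‖ ^ 2 - μ x)) ≤
      (2 * π * Cd ^ 2) * (l / δ ^ 3) + (∫ x, (‖v x‖ ^ 2 - max (μ x) 0) ^ 2) / l := by
    have iF : ContinuousOn (fun τ : ℝ => (l * Cd ^ 2 / 2) * (1 / (τ ^ 2 + δ ^ 2) ^ 2))
        (Icc 0 T) := by
      refine Continuous.continuousOn ?_
      exact ((Continuous.div (by fun_prop) (by fun_prop) fun τ => by positivity).const_mul _)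
    have iG := ann_integrable ρ T _ iF
    have iH : IntegrableOn (fun x => (‖v x‖ ^ 2 - max (μ x) 0) ^ 2 / l) (ann ρ T) :=
      (hint.div_const l).integrableOn
    have h1 := setIntegral_mono_on (f := fun x => Qf ρ T δ x * (‖v x‖ ^ 2 - μ x))
      (g := fun x => (l * Cd ^ 2 / 2) * (1 / ((ρ ^ 2 - ‖x‖ ^ 2) ^ 2 + δ ^ 2) ^ 2)
        + (‖v x‖ ^ 2 - max (μ x) 0) ^ 2 / l)
      (ContinuousOn.integrableOn_compact (ann_compact ρ T) (Continuous.continuousOn ?_)) (iG.add iH) (ann_meas ρ T) ?_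
    · refine h1.trans ?_
      rw [integral_add iG iH, rad_ann ρ T hT.le hTρ
        (fun τ : ℝ => (l * Cd ^ 2 / 2) * (1 / (τ ^ 2 + δ ^ 2) ^ 2)),
        intervalIntegral.integral_const_mul, integral_div]
      refine add_le_add ?_ ?_
      · have h2 := mul_le_mul_of_nonneg_left (int_err hT hδ)
          (show 0 ≤ π * (l * Cd ^ 2 / 2) by positivity)
        refine le_trans (le_of_eq (by ring)) (h2.trans (le_of_eq (by ring)))
      · gcongr
        · exact Eventually.of_forall fun x => sq_nonneg _
        · exact Measure.restrict_le_self
    · unfold Qf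
      fun_prop
    · intro x hx
      have hxρ : ‖x‖ ≤ ρ := abs_le_of_sq_le_sq' hx.2 hρ.le |>.2
      have hq := Qf_upper hT hδ hx
      rw [max_eq_left (mu_nonneg hμ hxρ)]
      set h := ‖v x‖ ^ 2 - μ x
      set D := (ρ ^ 2 - ‖x‖ ^ 2) ^ 2 + δ ^ 2
      have hD : 0 < D := by positivity
      have e1 : Qf ρ T δ x * h ≤ (Cd / D) * |h| := by
        calc _ ≤ |Qf ρ T δ x * h| := le_abs_self _
          _ = |Qf ρ T δ x| * |h| := abs_mul _ _
          _ ≤ _ := by gcongr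
      have e2 : 0 ≤ (l * (Cd / D) - |h|) ^ 2 / (2 * l) := by positivity
      have e3 : (l * (Cd / D) - |h|) ^ 2 / (2 * l)
          = (l * Cd ^ 2 / 2) * (1 / D ^ 2) - (Cd / D) * |h| + h ^ 2 / (2 * l) := by
        rw [← sq_abs h]; field_simp; ring
      have e4 : h ^ 2 / (2 * l) ≤ h ^ 2 / l := by
        apply div_le_div_of_nonneg_left (sq_nonneg _) hl (by linarith)
      show Qf ρ T δ x * h ≤ (l * Cd ^ 2 / 2) * (1 / D ^ 2) + h ^ 2 / l
      linarith
  have m1 := le_max_left (A * (1 / 2 - Real.log T) + π * (C * T)) (2 * π * Cd ^ 2)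
  have m2 := mul_le_mul_of_nonneg_right
    (le_max_right (A * (1 / 2 - Real.log T) + π * (C * T)) (2 * π * Cd ^ 2))
    (show 0 ≤ l / δ ^ 3 by positivity)
  linarith

end lower
section final

lemma log_abs_atTop : Tendsto (fun ε : ℝ => |Real.log ε|) (𝓝[>] 0) atTop :=
  tendsto_abs_atBot_atTop.comp Real.tendsto_log_nhdsGT_zero

lemma annulus_eq {ρ ρ0 : ℝ} (h0 : 0 < ρ0) (h1 : ρ0 < ρ) :
    {x : E2 | ρ0 ≤ ‖x‖ ∧ ‖x‖ ≤ ρ} = ann ρ (ρ ^ 2 - ρ0 ^ 2) := by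
  ext x
  simp only [ann, mem_setOf_eq, sub_sub_cancel]
  rw [sq_le_sq₀ h0.le (norm_nonneg x), sq_le_sq₀ (norm_nonneg x) (h0.trans h1).le]

end final
/-- lower bound for the gradient energy of global minimizers in the
annulus `ρ₀ ≤ |x| ≤ ρ`, when `a/(ε|ln ε|)` stays bounded as `ε → 0`:
`liminf_{ε→0} (1/|ln ε|) ∫_{ρ₀≤|x|≤ρ} (1/2)|∇v_ε|² ≥ π|μ₁|ρ/6`. -/
theorem statement14
    (μ : E2 → ℝ) (μrad : ℝ → ℝ) (ρ : ℝ) (f : E2 → E2) (frad : ℝ → ℝ)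
    (hμ : MuHyp μ μrad ρ) (hf : FHyp f frad)
    (a : ℝ → ℝ) (ha0 : ∀ ε : ℝ, 0 < ε → 0 ≤ a ε)
    (hrat : ∃ C : ℝ, ∀ᶠ ε in 𝓝[>] (0:ℝ), a ε / (ε * |Real.log ε|) ≤ C)
    (v : ℝ → E2 → E2) (hv : ∀ ε : ℝ, 0 < ε → IsMinimizer ε (a ε) μ f (v ε))
    (ρ0 : ℝ) (hρ0 : 0 < ρ0) (hρ0ρ : ρ0 < ρ) :
    π * |deriv μrad ρ| * ρ / 6 ≤
      Filter.liminf (fun ε : ℝ => (1/|Real.log ε|) *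
        ∫ x in {x : E2 | ρ0 ≤ ‖x‖ ∧ ‖x‖ ≤ ρ}, (1/2) * gradSq (v ε) x)
        (𝓝[>] (0:ℝ)) := by
  have hρ := hμ.rho_pos
  obtain ⟨C2, hC2, hap⟩ := apriori hμ hf a ha0 hrat v hv
  have hT : 0 < ρ ^ 2 - ρ0 ^ 2 := by nlinarith
  obtain ⟨C1, hlow⟩ := lower_bound hμ hT (by nlinarith)
  rw [annulus_eq hρ0 hρ0ρ]
  have hLtop := log_abs_atTop
  have hg : Tendsto (fun ε : ℝ => π * |deriv μrad ρ| * ρ / 6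
      - (1 / 2) * (C1 * |Real.log ε|⁻¹ + (C1 + C2) * (√|Real.log ε|)⁻¹)) (𝓝[>] 0)
      (𝓝 (π * |deriv μrad ρ| * ρ / 6 - (1 / 2) * (C1 * 0 + (C1 + C2) * 0))) := by
    have t1 := tendsto_inv_atTop_zero.comp hLtop
    have t2 := tendsto_inv_atTop_zero.comp (Real.tendsto_sqrt_atTop.comp hLtop)
    exact (((t1.const_mul C1).add (t2.const_mul (C1 + C2))).const_mul (1 / 2)).const_sub _
  have hc : π * |deriv μrad ρ| * ρ / 6 - (1 / 2) * (C1 * 0 + (C1 + C2) * 0)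
      = π * |deriv μrad ρ| * ρ / 6 := by ring
  rw [hc] at hg
  rw [← hg.liminf_eq]
  refine Filter.liminf_le_liminf ?_ hg.isBoundedUnder_ge ?_
  · filter_upwards [hap, eps_ev] with ε hε hev
    obtain ⟨hint, -, hH⟩ := hε
    obtain ⟨hε0, hε1, hL1⟩ := hev
    set L := |Real.log ε| with hL
    have hL0 : 0 < L := by linarith
    have hs : 0 < √L := Real.sqrt_pos.mpr hL0
    have hss : √L * √L = L := Real.mul_self_sqrt hL0.le
    have hlog : Real.log ε = -L := by
      rw [hL, abs_of_nonpos (Real.log_nonpos hε0.le hε1)]; ring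
    have hδ : 0 < ε ^ (2 / 3 : ℝ) := Real.rpow_pos_of_pos hε0 _
    have h1 := hlow (ε ^ (2 / 3 : ℝ)) hδ (ε ^ 2 * √L) (by positivity) (v ε) (hv ε hε0).1 hint
    have hδ3 : (ε ^ (2 / 3 : ℝ)) ^ 3 = ε ^ 2 := by
      rw [← Real.rpow_natCast, ← Real.rpow_mul hε0.le, ← Real.rpow_natCast]
      norm_num
    rw [Real.log_rpow hε0, hδ3, hlog, mul_div_cancel_left₀ _ (by positivity)] at h1
    have h2 : (∫ x, (‖v ε x‖ ^ 2 - max (μ x) 0) ^ 2) / (ε ^ 2 * √L) ≤ C2 * √L := by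
      rw [div_le_iff₀ (by positivity)]
      refine hH.trans (le_of_eq ?_)
      rw [show C2 * √L * (ε ^ 2 * √L) = C2 * (ε ^ 2 * (√L * √L)) by ring, hss]
    rw [integral_const_mul]
    have h3 : π * (ρ * |deriv μrad ρ| / 2) * (2 / 3 * L) - C1 - C1 * √L - C2 * √L
        ≤ ∫ x in ann ρ (ρ ^ 2 - ρ0 ^ 2), gradSq (v ε) x := by
      refine le_trans ?_ h1
      linarith
    have h4 := mul_le_mul_of_nonneg_left h3 (show 0 ≤ (1 / L) * (1 / 2) by positivity)
    rw [← mul_assoc]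
    refine le_trans (le_of_eq ?_) h4
    have h5 : (√L)⁻¹ = √L / L := by
      rw [inv_eq_one_div, div_eq_div_iff hs.ne' hL0.ne', hss, one_mul]
    rw [h5]
    field_simp
    ring
  · refine IsBoundedUnder.isCoboundedUnder_ge ⟨C2 / 2, ?_⟩
    rw [eventually_map]
    filter_upwards [hap, eps_ev] with ε hε hev
    obtain ⟨-, hG, -⟩ := hε
    obtain ⟨hε0, hε1, hL1⟩ := hev
    have hL0 : 0 < |Real.log ε| := by linarith
    rw [integral_const_mul]
    have h1 : ∫ x in ann ρ (ρ ^ 2 - ρ0 ^ 2), gradSq (v ε) x ≤ ∫ x, gradSq (v ε) x :=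
      setIntegral_le_integral (gradSq_integrable (hv ε hε0).1)
        (Eventually.of_forall fun x => gradSq_nonneg _ x)
    rw [one_div, inv_mul_le_iff₀ hL0]
    linarith
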